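/- arXiv:0807.4302 — 2 statements merged into one kernel-verified Lean document; each statement's English description precedes it below -/
import Mathlib

section
/- Let f = x·y·(x+y)·(x+2y) and g = x in ℚ[x,y]. For every b ∈ ℚ[s], b satisfies the Bernstein–Sato functional equation for the pair (f, g) if and only if (s + 3/4)(s + 1)²(s + 5/4)(s + 3/2)(s + 7/4)(s + 2) divides b in ℚ[s]; that is, b_{f,x}(s) = (s + 3/4)(s + 1)²(s + 5/4)(s + 3/2)(s + 7/4)(s + 2). -/
open MvPolynomial Polynomial

/-- The iterated formal partial derivative `∂^α = ∏ᵢ ∂_{xᵢ}^{αᵢ}` applied to a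
multivariate polynomial (the partial derivatives pairwise commute, so the order
of the fold is immaterial). -/
noncomputable def pdIter {σ : Type*} [Fintype σ] (α : σ → ℕ)
    (p : MvPolynomial σ ℚ) : MvPolynomial σ ℚ :=
  Finset.univ.toList.foldl (fun q i => (⇑(MvPolynomial.pderiv i))^[α i] q) p

/-- `b ∈ ℚ[s]` satisfies the Bernstein–Sato functional equation for the pair
`(f, g)`: there are finitely many multi-indices `α` and polynomials
`p_α ∈ (ℚ[x])[s]` with `b(m)·g·f^m = Σ_α p_α(m)·∂^α(g·f^(m+1))` for all `m ∈ ℕ`. -/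
def SatisfiesBS {σ : Type*} [Fintype σ] (f g : MvPolynomial σ ℚ)
    (b : Polynomial ℚ) : Prop :=
  ∃ (A : Finset (σ → ℕ)) (p : (σ → ℕ) → Polynomial (MvPolynomial σ ℚ)),
    ∀ m : ℕ,
      MvPolynomial.C (Polynomial.eval (m : ℚ) b) * g * f ^ m =
        ∑ α ∈ A, Polynomial.eval ((m : ℕ) : MvPolynomial σ ℚ) (p α) *
          pdIter α (g * f ^ (m + 1))

namespace BernsteinSato

/-- The quartic `x y (x + y) (x + 2 y)`. -/
noncomputable def quartic : MvPolynomial (Fin 2) ℚ :=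
  MvPolynomial.X 0 * MvPolynomial.X 1 * (MvPolynomial.X 0 + MvPolynomial.X 1) *
    (MvPolynomial.X 0 + 2 * MvPolynomial.X 1)

theorem pderiv_comm {σ : Type*} (i j : σ) (p : MvPolynomial σ ℚ) :
    pderiv i (pderiv j p) = pderiv j (pderiv i p) := by
  classical
  have h : ⁅(pderiv i : Derivation ℚ (MvPolynomial σ ℚ) (MvPolynomial σ ℚ)),
      (pderiv j : Derivation ℚ (MvPolynomial σ ℚ) (MvPolynomial σ ℚ))⁆ = 0 := by
    apply MvPolynomial.derivation_ext
    intro k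
    simp [Derivation.commutator_apply, pderiv_X, Pi.single_apply, apply_ite]
  have := congrArg (fun D => D p) h
  simpa [Derivation.commutator_apply, sub_eq_zero] using this

theorem iterate_pderiv_comm {σ : Type*} (i j : σ) (a b : ℕ) (p : MvPolynomial σ ℚ) :
    (pderiv i)^[a] ((pderiv j)^[b] p) = (pderiv j)^[b] ((pderiv i)^[a] p) :=
  (Function.Commute.iterate_iterate (f := pderiv i) (g := pderiv j)
    (fun q => pderiv_comm i j q) a b).eq p

theorem pdIter_fin_two (α : Fin 2 → ℕ) (p : MvPolynomial (Fin 2) ℚ) :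
    pdIter α p = (pderiv 0)^[α 0] ((pderiv 1)^[α 1] p) := by
  have hperm : (Finset.univ : Finset (Fin 2)).toList.Perm [0, 1] := by
    rw [← Multiset.coe_eq_coe, Finset.coe_toList]
    rfl
  unfold pdIter
  rw [hperm.foldl_eq' (fun i _ j _ q => iterate_pderiv_comm _ _ _ _ q)]
  exact iterate_pderiv_comm 1 0 _ _ p

theorem pderiv_pdIter (i : Fin 2) (α : Fin 2 → ℕ) (p : MvPolynomial (Fin 2) ℚ) :
    pderiv i (pdIter α p) = pdIter (α + Pi.single i 1) p := by
  rw [pdIter_fin_two, pdIter_fin_two]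
  fin_cases i
  · simp [Function.iterate_succ_apply']
  · have h := iterate_pderiv_comm 1 0 1 (α 0) ((pderiv 1)^[α 1] p)
    simpa [Function.iterate_succ_apply'] using h

/-- Coefficientwise partial derivative of a polynomial in `s`, compatible with specialization
of `s` and with `d/ds`. -/
theorem exists_coeff_pderiv (i : Fin 2) (Q : Polynomial (MvPolynomial (Fin 2) ℚ)) :
    ∃ Q' : Polynomial (MvPolynomial (Fin 2) ℚ), ∀ a : ℚ,
      Q'.eval (MvPolynomial.C a) = pderiv i (Q.eval (MvPolynomial.C a)) ∧
      (derivative Q').eval (MvPolynomial.C a) =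
        pderiv i ((derivative Q).eval (MvPolynomial.C a)) := by
  induction Q using Polynomial.induction_on' with
  | add p q hp hq =>
    obtain ⟨p', hp⟩ := hp
    obtain ⟨q', hq⟩ := hq
    exact ⟨p' + q', fun a => by simp [hp a, hq a]⟩
  | monomial n c =>
    refine ⟨Polynomial.monomial n (pderiv i c), fun a => ⟨?_, ?_⟩⟩
    · rw [Polynomial.eval_monomial, Polynomial.eval_monomial, ← map_pow, Derivation.leibniz,
        pderiv_C]
      simp [mul_comm]
    · rw [derivative_monomial, derivative_monomial, Polynomial.eval_monomial,
        Polynomial.eval_monomial, ← map_pow, ← map_natCast (MvPolynomial.C (σ := Fin 2)) n]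
      simp only [Derivation.leibniz, pderiv_C, smul_eq_mul]
      ring

/-- The family `m ↦ w m` is the specialization of an element of `D[s] g f ^ (s + 1)`. -/
def InDModule (f g : MvPolynomial (Fin 2) ℚ) (w : ℕ → MvPolynomial (Fin 2) ℚ) : Prop :=
  ∃ p : (Fin 2 → ℕ) →₀ Polynomial (MvPolynomial (Fin 2) ℚ), ∀ m : ℕ,
    w m = p.sum fun α c =>
      c.eval (MvPolynomial.C (m : ℚ)) * pdIter α (g * f ^ (m + 1))

section InDModule

variable {f g : MvPolynomial (Fin 2) ℚ} {v w : ℕ → MvPolynomial (Fin 2) ℚ}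

theorem InDModule.add (hv : InDModule f g v) (hw : InDModule f g w) :
    InDModule f g (fun m => v m + w m) := by
  classical
  obtain ⟨p, hp⟩ := hv
  obtain ⟨q, hq⟩ := hw
  refine ⟨p + q, fun m => ?_⟩
  change v m + w m = _
  rw [hp, hq, Finsupp.sum_add_index'] <;> intros <;> simp [add_mul]

theorem InDModule.single (α : Fin 2 → ℕ) (c : Polynomial (MvPolynomial (Fin 2) ℚ)) :
    InDModule f g (fun m => c.eval (MvPolynomial.C (m : ℚ)) * pdIter α (g * f ^ (m + 1))) :=
  ⟨Finsupp.single α c, fun m => by simp⟩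

theorem InDModule.induction {P : (ℕ → MvPolynomial (Fin 2) ℚ) → Prop}
    (h0 : P (fun _ => 0)) (hadd : ∀ v w, P v → P w → P (fun m => v m + w m))
    (hsingle : ∀ (α : Fin 2 → ℕ) (c : Polynomial (MvPolynomial (Fin 2) ℚ)),
      P (fun m => c.eval (MvPolynomial.C (m : ℚ)) * pdIter α (g * f ^ (m + 1))))
    (hw : InDModule f g w) : P w := by
  classical
  obtain ⟨p, hp⟩ := hw
  obtain rfl : w = fun m => _ := funext hp
  clear hp
  induction p using Finsupp.induction_linear with
  | zero => simpa using h0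
  | add p q hp hq =>
    have := hadd _ _ hp hq
    convert this using 2 with m
    rw [Finsupp.sum_add_index'] <;> intros <;> simp [add_mul]
  | single α c => simpa using hsingle α c

theorem InDModule.zero : InDModule f g (fun _ => 0) := ⟨0, fun m => by simp⟩

theorem InDModule.mul (q : Polynomial (MvPolynomial (Fin 2) ℚ)) (hw : InDModule f g w) :
    InDModule f g (fun m => q.eval (MvPolynomial.C (m : ℚ)) * w m) := by
  refine InDModule.induction
    (P := fun w => InDModule f g (fun m => q.eval (MvPolynomial.C (m : ℚ)) * w m))
    (by simpa using InDModule.zero) (fun v w hv hw => by simpa [mul_add] using hv.add hw)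
    (fun α c => by simpa [mul_assoc] using InDModule.single α (q * c)) hw

theorem InDModule.pderiv (i : Fin 2) (hw : InDModule f g w) :
    InDModule f g (fun m => MvPolynomial.pderiv i (w m)) := by
  refine InDModule.induction (P := fun w => InDModule f g (fun m => MvPolynomial.pderiv i (w m)))
    (by simpa using InDModule.zero) (fun v w hv hw => by simpa using hv.add hw)
    (fun α c => ?_) hw
  obtain ⟨c', hc⟩ := exists_coeff_pderiv i c
  have := (InDModule.single (f := f) (g := g) (α + Pi.single i 1) c).add
    (InDModule.single α c')
  convert this using 2 with m
  rw [Derivation.leibniz, pderiv_pdIter, (hc m).1, smul_eq_mul, smul_eq_mul,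
    mul_comm (pdIter α _)]

theorem InDModule.base : InDModule f g (fun m => g * f ^ (m + 1)) := by
  simpa [pdIter_fin_two] using InDModule.single (f := f) (g := g) 0 1

theorem InDModule.satisfiesBS {b : Polynomial ℚ}
    (h : InDModule f g (fun m => MvPolynomial.C (b.eval (m : ℚ)) * g * f ^ m)) :
    SatisfiesBS f g b := by
  obtain ⟨p, hp⟩ := h
  exact ⟨p.support, p, fun m => by simpa [Finsupp.sum] using hp m⟩

end InDModule

/-- `c(s) p x f ^ s` lies in `D[s] x f ^ (s + 1)`. -/
def Clears (c : Polynomial ℚ) (p : MvPolynomial (Fin 2) ℚ) : Prop :=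
  InDModule quartic (MvPolynomial.X 0)
    (fun m => MvPolynomial.C (c.eval (m : ℚ)) * (p * MvPolynomial.X 0 * quartic ^ m))

section Clears

variable {c d : Polynomial ℚ} {p q : MvPolynomial (Fin 2) ℚ}

theorem Clears.add (hp : Clears c p) (hq : Clears c q) : Clears c (p + q) := by
  have := InDModule.add hp hq
  unfold Clears
  convert this using 2 with m
  ring

theorem Clears.mul (hp : Clears c p) (q : MvPolynomial (Fin 2) ℚ) : Clears c (q * p) := by
  have := InDModule.mul (Polynomial.C q) hp
  unfold Clears
  convert this using 2 with m
  rw [Polynomial.eval_C]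
  ring

theorem Clears.smul (hp : Clears c p) (d : Polynomial ℚ) : Clears (d * c) p := by
  have := InDModule.mul (d.map MvPolynomial.C) hp
  unfold Clears
  convert this using 2 with m
  rw [Polynomial.eval_map_apply, Polynomial.eval_mul, map_mul]
  ring

theorem quartic_isHomogeneous : quartic.IsHomogeneous 4 := by
  have h0 := isHomogeneous_X ℚ (0 : Fin 2)
  have h1 := isHomogeneous_X ℚ (1 : Fin 2)
  have h2 : (MvPolynomial.X 0 + 2 * MvPolynomial.X 1 : MvPolynomial (Fin 2) ℚ).IsHomogeneous 1 :=
    h0.add (by simpa only [zero_add, map_ofNat] using (isHomogeneous_C (Fin 2) (2 : ℚ)).mul h1)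
  exact ((h0.mul h1).mul (h0.add h1)).mul h2

theorem Clears.euler {n : ℕ} (hp : p.IsHomogeneous n)
    (h : ∀ i, Clears c (MvPolynomial.X i * p)) :
    Clears ((4 * Polynomial.X + ((n : Polynomial ℚ) + 3)) * c) p := by
  have := (InDModule.pderiv 0 (h 0)).add (InDModule.pderiv 1 (h 1))
  unfold Clears
  convert this using 2 with m
  have hom : (p * MvPolynomial.X 0 * quartic ^ m).IsHomogeneous (n + 1 + 4 * m) :=
    (hp.mul (isHomogeneous_X ℚ 0)).mul (quartic_isHomogeneous.pow m)
  have euler := hom.sum_X_mul_pderiv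
  set w := p * MvPolynomial.X 0 * quartic ^ m
  rw [Fin.sum_univ_two, nsmul_eq_mul] at euler
  have e (i : Fin 2) : pderiv i (MvPolynomial.C (c.eval (m : ℚ)) *
      (MvPolynomial.X i * p * MvPolynomial.X 0 * quartic ^ m)) =
      MvPolynomial.C (c.eval (m : ℚ)) * (w + MvPolynomial.X i * pderiv i w) := by
    rw [pderiv_C_mul, show MvPolynomial.X i * p * MvPolynomial.X 0 * quartic ^ m =
      MvPolynomial.X i * w by ring, Derivation.leibniz, pderiv_X_self]
    simp only [smul_eq_mul]
    ring
  rw [e, e]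
  push_cast at euler
  simp only [Polynomial.eval_mul, Polynomial.eval_add, Polynomial.eval_X,
    Polynomial.eval_ofNat, Polynomial.eval_natCast, map_mul, map_add, map_natCast, map_ofNat]
  linear_combination (-MvPolynomial.C (c.eval (m : ℚ))) * euler

end Clears

/-- The form `y (x + y) (x + 2 y)`. -/
noncomputable def cubicForm : MvPolynomial (Fin 2) ℚ :=
  MvPolynomial.X 1 * (MvPolynomial.X 0 + MvPolynomial.X 1) *
    (MvPolynomial.X 0 + 2 * MvPolynomial.X 1)

theorem quartic_eq : quartic = MvPolynomial.X 0 * cubicForm := by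
  unfold quartic cubicForm
  ring

theorem pderiv_zero_quartic : pderiv 0 quartic = cubicForm +
    MvPolynomial.X 0 * (MvPolynomial.X 1 * (2 * MvPolynomial.X 0 + 3 * MvPolynomial.X 1)) := by
  have h2 : pderiv (0 : Fin 2) (2 : MvPolynomial (Fin 2) ℚ) = 0 := pderiv_C (a := (2 : ℚ))
  simp [quartic, cubicForm, Derivation.leibniz, pderiv_X, h2]
  ring

theorem pderiv_one_quartic : pderiv 1 quartic = MvPolynomial.X 0 * (MvPolynomial.X 0 ^ 2 +
    6 * MvPolynomial.X 0 * MvPolynomial.X 1 + 6 * MvPolynomial.X 1 ^ 2) := by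
  have h2 : pderiv (1 : Fin 2) (2 : MvPolynomial (Fin 2) ℚ) = 0 := pderiv_C (a := (2 : ℚ))
  simp [quartic, Derivation.leibniz, pderiv_X, h2]
  ring

theorem clears_pderiv_one : Clears (Polynomial.X + 1) (MvPolynomial.X 0 * (MvPolynomial.X 0 ^ 2 +
    6 * MvPolynomial.X 0 * MvPolynomial.X 1 + 6 * MvPolynomial.X 1 ^ 2)) := by
  have := (InDModule.base (f := quartic) (g := MvPolynomial.X 0)).pderiv 1
  unfold Clears
  convert this using 2 with m
  rw [Derivation.leibniz, pderiv_X_of_ne (by decide), pderiv_pow, pderiv_one_quartic]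
  simp
  ring

theorem clears_quartic : Clears 1 quartic := by
  have := InDModule.base (f := quartic) (g := MvPolynomial.X 0)
  unfold Clears
  convert this using 2 with m
  simp
  ring

theorem Clears.of_eq {p : MvPolynomial (Fin 2) ℚ} (u v : MvPolynomial (Fin 2) ℚ)
    (h : p = u * (MvPolynomial.X 0 ^ 2 + 6 * MvPolynomial.X 0 * MvPolynomial.X 1 +
      6 * MvPolynomial.X 1 ^ 2) + v * cubicForm) :
    Clears (Polynomial.X + 1) (MvPolynomial.X 0 * p) := by
  have h1 := (clears_quartic.smul (Polynomial.X + 1)).mul v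
  rw [mul_one] at h1
  have := (clears_pderiv_one.mul u).add h1
  convert this using 1
  rw [h, quartic_eq]
  ring

theorem clears_X_mul_deg_four {a b : ℕ} (hab : a + b = 4) :
    Clears (Polynomial.X + 1)
      (MvPolynomial.X 0 * (MvPolynomial.X 0 ^ a * MvPolynomial.X 1 ^ b)) := by
  obtain rfl : a = 4 - b := by omega
  have hb : b ≤ 4 := by omega
  set x : MvPolynomial (Fin 2) ℚ := MvPolynomial.X 0 with hx
  set y : MvPolynomial (Fin 2) ℚ := MvPolynomial.X 1 with hy
  have hc : (MvPolynomial.C (1 / 2 : ℚ) : MvPolynomial (Fin 2) ℚ) * 2 = 1 := by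
    rw [← map_ofNat (MvPolynomial.C (σ := Fin 2)) 2, ← map_mul]
    norm_num
  interval_cases b
  · refine Clears.of_eq (x ^ 2 + 12 * x * y + 12 * y ^ 2) (-18 * x - 36 * y) ?_
    simp only [cubicForm, ← hx, ← hy]
    ring
  · refine Clears.of_eq (-5 * x * y - 6 * y ^ 2) (6 * x + 18 * y) ?_
    simp only [cubicForm, ← hx, ← hy]
    ring
  · refine Clears.of_eq (3 * x * y + 4 * y ^ 2) (-3 * x - 12 * y) ?_
    simp only [cubicForm, ← hx, ← hy]
    ring
  · refine Clears.of_eq (-2 * x * y - 3 * y ^ 2) (2 * x + 9 * y) ?_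
    simp only [cubicForm, ← hx, ← hy]
    ring
  · refine Clears.of_eq (MvPolynomial.C (1 / 2) * (3 * x * y + 5 * y ^ 2))
      (MvPolynomial.C (1 / 2) * (-3 * x - 14 * y)) ?_
    simp only [cubicForm, ← hx, ← hy]
    linear_combination (-y ^ 4) * hc

theorem clears_X_one_pow_five : Clears ((Polynomial.X + 1) * (Polynomial.X + 2))
    (MvPolynomial.X 1 ^ 5) := by
  have h14 := clears_X_mul_deg_four (a := 1) (b := 3) rfl
  have h05 := clears_X_mul_deg_four (a := 0) (b := 4) rfl
  have h := ((InDModule.base (f := quartic) (g := MvPolynomial.X 0)).pderiv 0).mul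
    (Polynomial.C (MvPolynomial.C (1 / 2) * MvPolynomial.X 1 ^ 2) *
      (Polynomial.X + 1))
  have h1 := (h14.smul (-3 * Polynomial.X - 4)).mul (MvPolynomial.C (1 / 2))
  have h2 := (h05.smul (-6 * Polynomial.X - 9)).mul (MvPolynomial.C (1 / 2))
  have := (h.add h1).add h2
  unfold Clears
  convert this using 2 with m
  have hc : (MvPolynomial.C (1 / 2 : ℚ) : MvPolynomial (Fin 2) ℚ) * 2 = 1 := by
    rw [← map_ofNat (MvPolynomial.C (σ := Fin 2)) 2, ← map_mul]
    norm_num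
  rw [Derivation.leibniz, pderiv_X_self, pderiv_pow, pderiv_zero_quartic]
  simp only [Polynomial.eval_mul, Polynomial.eval_add, Polynomial.eval_sub, Polynomial.eval_neg,
    Polynomial.eval_X, Polynomial.eval_one, Polynomial.eval_C,
    Polynomial.eval_ofNat, map_mul, map_add, map_sub, map_neg, map_natCast, map_ofNat, map_one,
    smul_eq_mul, Nat.add_sub_cancel, Nat.cast_add, Nat.cast_one, pow_succ quartic m]
  rw [show quartic ^ m * quartic = quartic ^ m * (MvPolynomial.X 0 * cubicForm) by
    rw [← quartic_eq]]
  unfold cubicForm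
  linear_combination (-((m + 1) * (m + 2) * MvPolynomial.X 1 ^ 5 * MvPolynomial.X 0 *
    quartic ^ m)) * hc

theorem clears_deg_five {a b : ℕ} (hab : a + b = 5) :
    Clears ((Polynomial.X + 1) * (Polynomial.X + 2))
      (MvPolynomial.X 0 ^ a * MvPolynomial.X 1 ^ b) := by
  rcases a with _ | a
  · obtain rfl : b = 5 := by omega
    simpa using clears_X_one_pow_five
  · have := (clears_X_mul_deg_four (a := a) (b := b) (by omega)).smul (Polynomial.X + 2)
    rw [mul_comm (Polynomial.X + 2)] at this
    convert this using 1
    ring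

theorem clears_descent {n : ℕ} {c : Polynomial ℚ}
    (h : ∀ a b : ℕ, a + b = n + 1 → Clears c (MvPolynomial.X 0 ^ a * MvPolynomial.X 1 ^ b))
    (a b : ℕ) (hab : a + b = n) :
    Clears ((4 * Polynomial.X + ((n : Polynomial ℚ) + 3)) * c)
      (MvPolynomial.X 0 ^ a * MvPolynomial.X 1 ^ b) := by
  refine Clears.euler ?_ fun i => ?_
  · rw [← hab]
    exact (isHomogeneous_X_pow 0 a).mul (isHomogeneous_X_pow 1 b)
  · fin_cases i
    · convert h (a + 1) b (by omega) using 1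
      simp only [Fin.zero_eta]
      ring
    · convert h a (b + 1) (by omega) using 1
      simp only [Fin.mk_one]
      ring

theorem satisfiesBS_of_dvd {b : Polynomial ℚ}
    (hb : (Polynomial.X + Polynomial.C (3 / 4 : ℚ)) *
      (Polynomial.X + Polynomial.C (1 : ℚ)) ^ 2 *
      (Polynomial.X + Polynomial.C (5 / 4 : ℚ)) *
      (Polynomial.X + Polynomial.C (3 / 2 : ℚ)) *
      (Polynomial.X + Polynomial.C (7 / 4 : ℚ)) *
      (Polynomial.X + Polynomial.C (2 : ℚ)) ∣ b) :
    SatisfiesBS quartic (MvPolynomial.X 0) b := by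
  obtain ⟨e, rfl⟩ := hb
  have h := clears_descent (clears_descent (clears_descent (clears_descent
    (clears_descent (fun a b => clears_deg_five (a := a) (b := b)) (n := 4)) (n := 3))
    (n := 2)) (n := 1)) (n := 0) 0 0 rfl
  have h := h.smul (Polynomial.C (1 / 1024) * e)
  refine InDModule.satisfiesBS ?_
  unfold Clears at h
  convert h using 2 with m
  rw [mul_assoc (MvPolynomial.C _)]
  congr 2
  · simp
    ring
  · simp

section Univariate

/-- The dehomogenization of the quartic at `x = 1`. -/
noncomputable def cubic : Polynomial ℚ := 2 * Polynomial.X ^ 3 + 3 * Polynomial.X ^ 2 + Polynomial.X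

theorem derivative_cubic :
    derivative cubic = 6 * Polynomial.X ^ 2 + 6 * Polynomial.X + 1 := by
  have h2 : derivative (2 : Polynomial ℚ) = 0 := derivative_C (a := (2 : ℚ))
  have h3 : derivative (3 : Polynomial ℚ) = 0 := derivative_C (a := (3 : ℚ))
  simp only [cubic, derivative_add, derivative_mul, h2, h3, derivative_X_pow, derivative_X,
    Nat.cast_ofNat, map_ofNat]
  ring

theorem isCoprime_cubic : IsCoprime cubic (derivative cubic) := by
  refine ⟨-36 * Polynomial.X - 18, 12 * Polynomial.X ^ 2 + 12 * Polynomial.X + 1, ?_⟩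
  rw [derivative_cubic, cubic]
  ring

theorem cubic_ne_zero : cubic ≠ 0 := by
  intro h
  have := congrArg (Polynomial.eval 1) h
  norm_num [cubic] at this

/-- Poles of a primitive of `(c - r k) k ^ (τ - 1)`, with `k` the cubic, can be cleared. -/
theorem exists_primitive_of_pole {c r τ : ℚ} (K : ℕ) (hτ : ∀ i < K, τ ≠ i + 1)
    (h : ∃ A : Polynomial ℚ, Polynomial.C c * cubic ^ K = Polynomial.C r * cubic ^ (K + 1) +
      cubic * derivative A + Polynomial.C (τ - K) * derivative cubic * A) :
    ∃ A : Polynomial ℚ, Polynomial.C c = Polynomial.C r * cubic +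
      cubic * derivative A + Polynomial.C τ * derivative cubic * A := by
  induction K with
  | zero => simpa using h
  | succ K ih =>
    refine ih (fun i hi => hτ i (by omega)) ?_
    obtain ⟨A, hA⟩ := h
    have hdvd : cubic ∣ derivative cubic * (Polynomial.C (τ - (K + 1 : ℕ)) * A) := by
      refine ⟨Polynomial.C c * cubic ^ K - Polynomial.C r * cubic ^ (K + 1) - derivative A, ?_⟩
      linear_combination -hA
    have hunit : IsUnit (Polynomial.C (τ - (K + 1 : ℕ))) := by
      rw [Polynomial.isUnit_C, isUnit_iff_ne_zero, sub_ne_zero]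
      simpa using hτ K (by omega)
    obtain ⟨B, rfl⟩ := hunit.dvd_mul_left.mp (isCoprime_cubic.dvd_of_dvd_mul_left hdvd)
    refine ⟨B, mul_left_cancel₀ cubic_ne_zero ?_⟩
    rw [derivative_mul] at hA
    simp only [map_sub, map_natCast, Nat.cast_add, Nat.cast_one, map_add, map_one] at hA ⊢
    linear_combination hA

theorem eq_zero_of_primitive {c r τ : ℚ} (hτ : ∀ n : ℕ, 2 ≤ n → (2 * n + 6 * τ : ℚ) ≠ 0)
    {A : Polynomial ℚ} (hA : Polynomial.C c = Polynomial.C r * cubic +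
      cubic * derivative A + Polynomial.C τ * derivative cubic * A) : c = 0 := by
  have hdeg : A.natDegree < 2 := by
    by_contra! hn
    obtain ⟨e, he⟩ := Nat.exists_eq_add_of_le' hn
    have hzero (i : ℕ) (hi : e + 2 < i) : A.coeff i = 0 :=
      Polynomial.coeff_eq_zero_of_natDegree_lt (by omega)
    have hlead : A.coeff (e + 2) ≠ 0 := by
      rw [← he, Polynomial.coeff_natDegree, Polynomial.leadingCoeff_ne_zero]
      rintro rfl
      simp at hn
    have h := congrArg (fun p => p.coeff (e + 4)) hA
    have hexp : Polynomial.C r * cubic +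
      cubic * derivative A + Polynomial.C τ * derivative cubic * A =
      Polynomial.C (2 * r) * Polynomial.X ^ 3 + Polynomial.C (3 * r) * Polynomial.X ^ 2 +
      Polynomial.C r * Polynomial.X ^ 1 + Polynomial.C 2 * (Polynomial.X ^ 3 * derivative A) +
      Polynomial.C 3 * (Polynomial.X ^ 2 * derivative A) + Polynomial.X ^ 1 * derivative A +
      Polynomial.C (6 * τ) * (Polynomial.X ^ 2 * A) +
      Polynomial.C (6 * τ) * (Polynomial.X ^ 1 * A) + Polynomial.C τ * A := by
      rw [derivative_cubic, cubic]
      simp only [map_mul, map_ofNat]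
      ring
    rw [hexp] at h
    simp only [Polynomial.coeff_add, Polynomial.coeff_C_mul, Polynomial.coeff_X_pow_mul',
      Polynomial.coeff_C, Polynomial.coeff_X_pow, Polynomial.coeff_derivative] at h
    rw [hzero (e + 4) (by omega), hzero (e + 4 - 1) (by omega), hzero (e + 4 - 1 + 1) (by omega),
      hzero (e + 4 - 2 + 1) (by omega), show e + 4 - 3 + 1 = e + 2 by omega,
      show e + 4 - 2 = e + 2 by omega, show e + 4 - 3 = e + 1 by omega] at h
    simp at h
    have h2 := hτ (e + 2) (by omega)
    push_cast at h2
    apply mul_ne_zero h2 hlead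
    linear_combination -h
  obtain ⟨a0, a1, rfl⟩ : ∃ a0 a1, A = Polynomial.C a1 * Polynomial.X + Polynomial.C a0 :=
    ⟨_, _, Polynomial.eq_X_add_C_of_natDegree_le_one (by omega)⟩
  have hexp : Polynomial.C r * cubic +
      cubic * derivative (Polynomial.C a1 * Polynomial.X + Polynomial.C a0) +
      Polynomial.C τ * derivative cubic * (Polynomial.C a1 * Polynomial.X + Polynomial.C a0) =
      Polynomial.C (2 * r + 2 * a1 + 6 * τ * a1) * Polynomial.X ^ 3 +
      Polynomial.C (3 * r + 3 * a1 + 6 * τ * (a0 + a1)) * Polynomial.X ^ 2 +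
      Polynomial.C (r + a1 + τ * (6 * a0 + a1)) * Polynomial.X + Polynomial.C (τ * a0) := by
    rw [derivative_cubic, cubic]
    simp only [derivative_mul, derivative_C, derivative_X, map_mul, map_add, map_ofNat]
    ring
  rw [hexp] at hA
  have h0 := congrArg (fun p => p.coeff 0) hA
  have h1 := congrArg (fun p => p.coeff 1) hA
  have h2 := congrArg (fun p => p.coeff 2) hA
  have h3 := congrArg (fun p => p.coeff 3) hA
  simp only [Polynomial.coeff_add, Polynomial.coeff_C_mul, Polynomial.coeff_X_pow,
    Polynomial.coeff_X, Polynomial.coeff_C] at h0 h1 h2 h3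
  norm_num at h0 h1 h2 h3
  rcases eq_or_ne τ 0 with rfl | hτ0
  · simpa using h0
  have e1 : a1 = 2 * a0 := by
    refine mul_left_cancel₀ hτ0 ?_
    linear_combination (1 / 3) * h2 - (1 / 2) * h3
  have : a0 = 0 := by
    refine mul_left_cancel₀ hτ0 ?_
    rw [e1] at h1 h3
    linear_combination (-1 / 2) * h1 + (1 / 4) * h3
  rw [h0, this, mul_zero]

end Univariate

section Dehomogenization

/-- The substitution `x ↦ z`, `y ↦ t z`. -/
noncomputable def blowup : MvPolynomial (Fin 2) ℚ →ₐ[ℚ] Polynomial (Polynomial ℚ) :=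
  MvPolynomial.aeval ![Polynomial.X, Polynomial.C Polynomial.X * Polynomial.X]

/-- The value at `(1, t)` of the homogeneous component of degree `n`. -/
noncomputable def dehom (n : ℕ) (p : MvPolynomial (Fin 2) ℚ) : Polynomial ℚ :=
  (blowup p).coeff n

theorem blowup_X_zero : blowup (MvPolynomial.X 0) = Polynomial.X := by simp [blowup]

theorem blowup_X_one : blowup (MvPolynomial.X 1) = Polynomial.C Polynomial.X * Polynomial.X := by
  simp [blowup]

theorem blowup_C (a : ℚ) : blowup (MvPolynomial.C a) = Polynomial.C (Polynomial.C a) :=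
  blowup.commutes a

theorem blowup_quartic : blowup quartic = Polynomial.C cubic * Polynomial.X ^ 4 := by
  simp only [quartic, cubic, map_mul, map_add, map_ofNat, map_pow, blowup_X_zero, blowup_X_one]
  ring

theorem blowup_pderiv_zero_quartic : blowup (pderiv 0 quartic) =
    Polynomial.C (4 * cubic - Polynomial.X * derivative cubic) * Polynomial.X ^ 3 := by
  rw [pderiv_zero_quartic, derivative_cubic]
  simp only [cubicForm, cubic, map_mul, map_add, map_sub, map_ofNat, map_pow, map_one,
    blowup_X_zero, blowup_X_one]
  ring

theorem blowup_pderiv_one_quartic : blowup (pderiv 1 quartic) =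
    Polynomial.C (derivative cubic) * Polynomial.X ^ 3 := by
  rw [pderiv_one_quartic, derivative_cubic]
  simp only [map_mul, map_add, map_ofNat, map_pow, map_one, blowup_X_zero, blowup_X_one]
  ring

theorem dehom_add (n : ℕ) (p q : MvPolynomial (Fin 2) ℚ) :
    dehom n (p + q) = dehom n p + dehom n q := by
  simp [dehom]

theorem dehom_mul_of_blowup_eq {g : MvPolynomial (Fin 2) ℚ} {u : Polynomial ℚ} {d : ℕ}
    (hg : blowup g = Polynomial.C u * Polynomial.X ^ d) (n : ℕ) (p : MvPolynomial (Fin 2) ℚ) :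
    dehom (n + d) (g * p) = u * dehom n p := by
  rw [dehom, map_mul, hg, mul_assoc, Polynomial.coeff_C_mul, Polynomial.coeff_X_pow_mul, dehom]

theorem dehom_mul_of_blowup_eq_of_lt {g : MvPolynomial (Fin 2) ℚ} {u : Polynomial ℚ} {d n : ℕ}
    (hg : blowup g = Polynomial.C u * Polynomial.X ^ d) (hn : n < d)
    (p : MvPolynomial (Fin 2) ℚ) : dehom n (g * p) = 0 := by
  rw [dehom, map_mul, hg, mul_assoc, Polynomial.coeff_C_mul, Polynomial.coeff_X_pow_mul',
    if_neg (by omega), mul_zero]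

theorem blowup_monomial (e : Fin 2 →₀ ℕ) (a : ℚ) : blowup (MvPolynomial.monomial e a) =
    Polynomial.monomial (e 0 + e 1) (Polynomial.monomial (e 1) a) := by
  rw [MvPolynomial.monomial_eq, Finsupp.prod_fintype _ _ (by simp), Fin.prod_univ_two]
  simp only [map_mul, map_pow, blowup_C, blowup_X_zero, blowup_X_one]
  rw [← Polynomial.C_mul_X_pow_eq_monomial, ← Polynomial.C_mul_X_pow_eq_monomial, map_mul, map_pow]
  ring

theorem dehom_monomial (n : ℕ) (e : Fin 2 →₀ ℕ) (a : ℚ) :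
    dehom n (MvPolynomial.monomial e a) =
      if e 0 + e 1 = n then Polynomial.monomial (e 1) a else 0 := by
  rw [dehom, blowup_monomial, Polynomial.coeff_monomial]

theorem dehom_zero_eq (p : MvPolynomial (Fin 2) ℚ) : ∃ r : ℚ, dehom 0 p = Polynomial.C r := by
  induction p using MvPolynomial.induction_on' with
  | monomial e a =>
    rw [dehom_monomial]
    split_ifs with h
    · exact ⟨a, by rw [show e 1 = 0 by omega]; rfl⟩
    · exact ⟨0, by simp⟩
  | add p q hp hq =>
    obtain ⟨r, hr⟩ := hp
    obtain ⟨s, hs⟩ := hq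
    exact ⟨r + s, by rw [dehom_add, hr, hs, map_add]⟩

theorem dehom_pderiv_one (n : ℕ) (p : MvPolynomial (Fin 2) ℚ) :
    dehom n (pderiv 1 p) = derivative (dehom (n + 1) p) := by
  induction p using MvPolynomial.induction_on' with
  | monomial e a =>
    rw [pderiv_monomial, dehom_monomial, dehom_monomial]
    rcases Nat.eq_zero_or_pos (e 1) with h | h
    · simp [h]
      split_ifs <;> simp
    · have : (e 0 + (e 1 - 1) = n) ↔ (e 0 + e 1 = n + 1) := by omega
      simp [this]
      split_ifs <;> simp [Polynomial.derivative_monomial]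
  | add p q hp hq => simp [dehom_add, hp, hq]

theorem dehom_pderiv_zero (n : ℕ) (p : MvPolynomial (Fin 2) ℚ) :
    dehom n (pderiv 0 p) = Polynomial.C (n + 1 : ℚ) * dehom (n + 1) p -
      Polynomial.X * derivative (dehom (n + 1) p) := by
  induction p using MvPolynomial.induction_on' with
  | monomial e a =>
    rw [pderiv_monomial, dehom_monomial, dehom_monomial]
    have hX (k : ℕ) : Polynomial.X * derivative (Polynomial.monomial k a) =
        Polynomial.monomial k (a * k) := by
      rw [Polynomial.derivative_monomial]
      rcases k with _ | k
      · simp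
      · simp [Polynomial.X_mul_monomial]
    by_cases h1 : e 0 + e 1 = n + 1
    · rw [if_pos h1, hX, Polynomial.C_mul_monomial, ← map_sub]
      have h1' : (e 0 + e 1 : ℚ) = n + 1 := by exact_mod_cast h1
      rcases Nat.eq_zero_or_pos (e 0) with h | h
      · rw [← h1', h]
        simp [mul_comm]
      · have h2 : (e - Finsupp.single 0 1 : Fin 2 →₀ ℕ) 0 +
            (e - Finsupp.single 0 1 : Fin 2 →₀ ℕ) 1 = n := by
          simp
          omega
        rw [if_pos h2, ← h1', show (e - Finsupp.single 0 1 : Fin 2 →₀ ℕ) 1 = e 1 by simp]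
        congr 1
        ring
    · rw [if_neg h1]
      rcases Nat.eq_zero_or_pos (e 0) with h | h
      · simp [h]
      · simp
        omega
  | add p q hp hq =>
    rw [map_add, dehom_add, dehom_add, hp, hq, derivative_add]
    ring

end Dehomogenization

section Specialization

theorem eq_zero_of_twisted_exact {j K : ℕ} {c σ : ℚ} (hj : j ≤ 4) (hσ : 4 * σ + 3 + j = 0)
    {r U V E : MvPolynomial (Fin 2) ℚ} (hE : dehom (4 * K + 5 + j) E = 0)
    (h : MvPolynomial.C c * (MvPolynomial.X 0 ^ (j + 1) * quartic ^ (K + 1)) =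
      r * (MvPolynomial.X 0 * quartic ^ (K + 2)) +
      (quartic * pderiv 0 U + MvPolynomial.C (σ - K) * (pderiv 0 quartic * U)) +
      (quartic * pderiv 1 V + MvPolynomial.C (σ - K) * (pderiv 1 quartic * V)) + E) : c = 0 := by
  have hj' : (j : ℚ) ≤ 4 := by exact_mod_cast hj
  have hσ' : σ = -(3 + j) / 4 := by linarith
  have hpow (n : ℕ) : blowup (quartic ^ n) =
      Polynomial.C (cubic ^ n) * Polynomial.X ^ (4 * n) := by
    rw [map_pow, blowup_quartic, mul_pow, ← pow_mul, map_pow]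
  have hC (a : ℚ) : blowup (MvPolynomial.C a) =
      Polynomial.C (Polynomial.C a) * Polynomial.X ^ 0 := by
    rw [blowup_C, pow_zero, mul_one]
  have hC' (a : ℚ) (n : ℕ) (p) : dehom n (MvPolynomial.C a * p) = Polynomial.C a * dehom n p :=
    dehom_mul_of_blowup_eq (hC a) n p
  obtain ⟨ρ, hρ⟩ : ∃ ρ : ℚ, dehom (4 * K + 5 + j) (r * (MvPolynomial.X 0 * quartic ^ (K + 2))) =
      Polynomial.C ρ * cubic ^ (K + 2) := by
    have hb : blowup (MvPolynomial.X 0 * quartic ^ (K + 2)) =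
        Polynomial.C (cubic ^ (K + 2)) * Polynomial.X ^ (4 * K + 9) := by
      rw [map_mul, hpow, blowup_X_zero]
      ring
    rw [mul_comm r]
    rcases hj.lt_or_eq with hlt | rfl
    · exact ⟨0, by rw [dehom_mul_of_blowup_eq_of_lt hb (by omega)]; simp⟩
    · obtain ⟨ρ, hρ⟩ := dehom_zero_eq r
      refine ⟨ρ, ?_⟩
      rw [show 4 * K + 5 + 4 = 0 + (4 * K + 9) by omega, dehom_mul_of_blowup_eq hb, hρ, mul_comm]
  have hlhs : dehom (4 * K + 5 + j)
      (MvPolynomial.C c * (MvPolynomial.X 0 ^ (j + 1) * quartic ^ (K + 1))) =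
      Polynomial.C c * cubic ^ (K + 1) := by
    rw [hC', dehom, map_mul, hpow, map_pow, blowup_X_zero,
      show (Polynomial.X ^ (j + 1) * (Polynomial.C (cubic ^ (K + 1)) *
        Polynomial.X ^ (4 * (K + 1))) : Polynomial (Polynomial ℚ)) =
        Polynomial.C (cubic ^ (K + 1)) * Polynomial.X ^ (4 * K + 5 + j) by ring,
      Polynomial.coeff_C_mul_X_pow, if_pos rfl]
  have hq (p) : dehom (4 * K + 5 + j) (quartic * p) = cubic * dehom (4 * K + 1 + j) p := by
    rw [show 4 * K + 5 + j = 4 * K + 1 + j + 4 by omega, dehom_mul_of_blowup_eq blowup_quartic]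
  have hx (p) : dehom (4 * K + 5 + j) (pderiv 0 quartic * p) =
      (4 * cubic - Polynomial.X * derivative cubic) * dehom (4 * K + 1 + j + 1) p := by
    rw [show 4 * K + 5 + j = 4 * K + 1 + j + 1 + 3 by omega,
      dehom_mul_of_blowup_eq blowup_pderiv_zero_quartic]
  have hy (p) : dehom (4 * K + 5 + j) (pderiv 1 quartic * p) =
      derivative cubic * dehom (4 * K + 1 + j + 1) p := by
    rw [show 4 * K + 5 + j = 4 * K + 1 + j + 1 + 3 by omega,
      dehom_mul_of_blowup_eq blowup_pderiv_one_quartic]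
  have h := congrArg (dehom (4 * K + 5 + j)) h
  rw [hlhs, dehom_add, dehom_add, dehom_add, dehom_add, dehom_add, hρ, hq, hq, hC', hC', hx, hy,
    dehom_pderiv_zero, dehom_pderiv_one, hE] at h
  set u := dehom (4 * K + 1 + j + 1) U
  set v := dehom (4 * K + 1 + j + 1) V
  obtain ⟨A, hA⟩ := exists_primitive_of_pole (c := c) (r := ρ) (τ := σ + 1) (K + 1)
    (fun i _ => by
      have : (0 : ℚ) ≤ i := i.cast_nonneg
      have : (0 : ℚ) ≤ j := j.cast_nonneg
      apply ne_of_lt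
      linarith) ⟨v - Polynomial.X * u, by
    have hσC : 4 * Polynomial.C σ + 3 + (j : Polynomial ℚ) = 0 := by
      have := congrArg Polynomial.C hσ
      simpa only [map_add, map_mul, map_ofNat, map_natCast, map_zero] using this
    simp only [derivative_sub, derivative_mul, derivative_X]
    simp only [map_sub, map_add, map_natCast, map_one, Nat.cast_add, Nat.cast_one, Nat.cast_mul,
      Nat.cast_ofNat, map_mul, map_ofNat] at h ⊢
    linear_combination h + cubic * u * hσC⟩
  refine eq_zero_of_primitive (fun n hn => ?_) hA
  rw [hσ']
  intro h0
  have h1 : (4 * n : ℚ) + 3 = 3 * j := by linarith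
  have h2 : 4 * n + 3 = 3 * j := by exact_mod_cast h1
  omega

end Specialization

section QuasiPolynomial

theorem mul_pderiv_pow (i : Fin 2) (f : MvPolynomial (Fin 2) ℚ) (n : ℕ) :
    f * pderiv i (f ^ n) = n * f ^ n * pderiv i f := by
  rcases n with _ | n
  · simp
  · rw [pderiv_pow, Nat.add_sub_cancel]
    ring

theorem pow_mul_pderiv {i : Fin 2} {K m : ℕ} {w q : MvPolynomial (Fin 2) ℚ}
    (h : quartic ^ K * w = q * quartic ^ m) :
    quartic ^ (K + 1) * pderiv i w =
      (quartic * pderiv i q + MvPolynomial.C (m - K : ℚ) * (pderiv i quartic * q)) *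
        quartic ^ m := by
  have h1 := congrArg (pderiv i) h
  rw [Derivation.leibniz, Derivation.leibniz] at h1
  simp only [smul_eq_mul, map_sub, map_natCast] at h1 ⊢
  linear_combination quartic * h1 - w * mul_pderiv_pow i quartic K +
    q * mul_pderiv_pow i quartic m - K * pderiv i quartic * h

theorem quartic_pow_dvd_pderiv (i : Fin 2) {K : ℕ} {q : MvPolynomial (Fin 2) ℚ}
    (h : quartic ^ (K + 1) ∣ q) :
    quartic ^ (K + 2) ∣
      quartic * pderiv i q + MvPolynomial.C (-1 - K : ℚ) * (pderiv i quartic * q) := by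
  obtain ⟨g, rfl⟩ := h
  refine ⟨pderiv i g, ?_⟩
  rw [Derivation.leibniz]
  simp only [smul_eq_mul, map_sub, map_natCast, map_neg, map_one]
  have := mul_pderiv_pow i quartic (K + 1)
  push_cast at this
  linear_combination g * this

theorem X_pow_dvd_pderiv (i : Fin 2) {K : ℕ} {q : MvPolynomial (Fin 2) ℚ}
    (h : MvPolynomial.X 0 ^ (K + 2) ∣ q) :
    MvPolynomial.X 0 ^ (K + 3) ∣
      quartic * pderiv i q + MvPolynomial.C (-2 - K : ℚ) * (pderiv i quartic * q) := by
  obtain ⟨g, rfl⟩ := h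
  refine ⟨cubicForm * pderiv i g - (K + 2) * pderiv i cubicForm * g, ?_⟩
  have := mul_pderiv_pow i (MvPolynomial.X 0) (K + 2)
  rw [quartic_eq, Derivation.leibniz, Derivation.leibniz]
  simp only [smul_eq_mul, map_sub, map_natCast, map_neg, map_ofNat]
  push_cast at this
  linear_combination cubicForm * g * this

/-- `w m = Q(m) f ^ (m - K)` for all `m`, where the specializations of the right-hand side at
`s = -1` and `s = -2` have no pole, respectively no pole along `x = 0`. -/
def QuasiAt (K : ℕ) (w : ℕ → MvPolynomial (Fin 2) ℚ) : Prop :=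
  ∃ Q : Polynomial (MvPolynomial (Fin 2) ℚ),
    (∀ m : ℕ, quartic ^ K * w m = Q.eval (MvPolynomial.C (m : ℚ)) * quartic ^ m) ∧
    quartic ^ (K + 1) ∣ Q.eval (MvPolynomial.C (-1)) ∧
    MvPolynomial.X 0 ^ (K + 2) ∣ Q.eval (MvPolynomial.C (-2))

variable {K : ℕ} {v w : ℕ → MvPolynomial (Fin 2) ℚ}

theorem QuasiAt.succ (h : QuasiAt K w) : QuasiAt (K + 1) w := by
  obtain ⟨Q, hQ, h1, h2⟩ := h
  refine ⟨Polynomial.C quartic * Q, fun m => ?_, ?_, ?_⟩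
  · rw [Polynomial.eval_mul, Polynomial.eval_C]
    linear_combination quartic * hQ m
  · rw [Polynomial.eval_mul, Polynomial.eval_C, pow_succ' quartic]
    exact mul_dvd_mul_left _ h1
  · rw [Polynomial.eval_mul, Polynomial.eval_C, quartic_eq, mul_assoc, pow_succ']
    exact mul_dvd_mul_left _ (h2.mul_left _)

theorem QuasiAt.mono {L : ℕ} (h : QuasiAt K w) (hKL : K ≤ L) : QuasiAt L w := by
  induction L, hKL using Nat.le_induction with
  | base => exact h
  | succ L _ ih => exact ih.succ

theorem QuasiAt.add (hv : QuasiAt K v) (hw : QuasiAt K w) : QuasiAt K (fun m => v m + w m) := by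
  obtain ⟨P, hP, h1, h2⟩ := hv
  obtain ⟨Q, hQ, h3, h4⟩ := hw
  refine ⟨P + Q, fun m => ?_, ?_, ?_⟩
  · rw [Polynomial.eval_add]
    linear_combination hP m + hQ m
  · rw [Polynomial.eval_add]
    exact dvd_add h1 h3
  · rw [Polynomial.eval_add]
    exact dvd_add h2 h4

theorem QuasiAt.mul (c : Polynomial (MvPolynomial (Fin 2) ℚ)) (hw : QuasiAt K w) :
    QuasiAt K (fun m => c.eval (MvPolynomial.C (m : ℚ)) * w m) := by
  obtain ⟨Q, hQ, h1, h2⟩ := hw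
  refine ⟨c * Q, fun m => ?_, ?_, ?_⟩
  · rw [Polynomial.eval_mul]
    linear_combination c.eval (MvPolynomial.C (m : ℚ)) * hQ m
  · rw [Polynomial.eval_mul]
    exact h1.mul_left _
  · rw [Polynomial.eval_mul]
    exact h2.mul_left _

theorem QuasiAt.pderiv (i : Fin 2) (hw : QuasiAt K w) :
    QuasiAt (K + 1) (fun m => MvPolynomial.pderiv i (w m)) := by
  obtain ⟨Q, hQ, h1, h2⟩ := hw
  obtain ⟨D, hD⟩ := exists_coeff_pderiv i Q
  obtain ⟨Q', heval⟩ : ∃ Q' : Polynomial (MvPolynomial (Fin 2) ℚ), ∀ a : ℚ,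
      Q'.eval (MvPolynomial.C a) = quartic * MvPolynomial.pderiv i (Q.eval (MvPolynomial.C a)) +
        MvPolynomial.C (a - K) * (MvPolynomial.pderiv i quartic * Q.eval (MvPolynomial.C a)) :=
    ⟨Polynomial.C quartic * D + (Polynomial.X - Polynomial.C (MvPolynomial.C (K : ℚ))) *
      (Polynomial.C (MvPolynomial.pderiv i quartic) * Q), fun a => by
        simp only [Polynomial.eval_add, Polynomial.eval_sub, Polynomial.eval_mul,
          Polynomial.eval_C, Polynomial.eval_X, map_sub, (hD a).1]⟩
  refine ⟨Q', fun m => ?_, ?_, ?_⟩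
  · rw [heval]
    exact pow_mul_pderiv (hQ m)
  · rw [heval]
    exact quartic_pow_dvd_pderiv i h1
  · rw [heval]
    exact X_pow_dvd_pderiv i h2

/-- Families of the form `Q(m) f ^ (m - K)` for some `K`, regular as in `QuasiAt`. -/
def Quasi (w : ℕ → MvPolynomial (Fin 2) ℚ) : Prop := ∃ K, QuasiAt K w

theorem Quasi.add (hv : Quasi v) (hw : Quasi w) : Quasi (fun m => v m + w m) := by
  obtain ⟨K, hv⟩ := hv
  obtain ⟨L, hw⟩ := hw
  exact ⟨max K L, (hv.mono (le_max_left _ _)).add (hw.mono (le_max_right _ _))⟩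

theorem Quasi.mul (c : Polynomial (MvPolynomial (Fin 2) ℚ)) (hw : Quasi w) :
    Quasi (fun m => c.eval (MvPolynomial.C (m : ℚ)) * w m) :=
  hw.imp fun _ h => h.mul c

theorem Quasi.pderiv (i : Fin 2) (hw : Quasi w) :
    Quasi (fun m => MvPolynomial.pderiv i (w m)) := by
  obtain ⟨K, h⟩ := hw
  exact ⟨K + 1, h.pderiv i⟩

theorem Quasi.zero : Quasi (fun _ => 0) := ⟨0, 0, by simp⟩

theorem Quasi.base : Quasi (fun m => MvPolynomial.X 0 * quartic ^ (m + 1)) := by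
  refine ⟨0, Polynomial.C (MvPolynomial.X 0 * quartic), fun m => ?_, ?_, ?_⟩
  · rw [Polynomial.eval_C]
    ring
  · rw [Polynomial.eval_C, zero_add, pow_one]
    exact dvd_mul_left _ _
  · rw [Polynomial.eval_C, quartic_eq]
    exact ⟨cubicForm, by ring⟩

/-- `w` is a multiple of `x f ^ (s + 1)` up to divergences. -/
def BaseModExact (w : ℕ → MvPolynomial (Fin 2) ℚ) : Prop :=
  ∃ (r : Polynomial (MvPolynomial (Fin 2) ℚ)) (u v : ℕ → MvPolynomial (Fin 2) ℚ),
    Quasi u ∧ Quasi v ∧ ∀ m : ℕ, w m = r.eval (MvPolynomial.C (m : ℚ)) *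
      (MvPolynomial.X 0 * quartic ^ (m + 1)) + pderiv 0 (u m) + pderiv 1 (v m)

theorem BaseModExact.add (hv : BaseModExact v) (hw : BaseModExact w) :
    BaseModExact (fun m => v m + w m) := by
  obtain ⟨r, a, b, ha, hb, h⟩ := hv
  obtain ⟨r', a', b', ha', hb', h'⟩ := hw
  refine ⟨r + r', _, _, ha.add ha', hb.add hb', fun m => ?_⟩
  dsimp only
  rw [h, h', Polynomial.eval_add, map_add, map_add]
  ring

theorem BaseModExact.pderiv (i : Fin 2) (hw : Quasi w) :
    BaseModExact (fun m => MvPolynomial.pderiv i (w m)) := by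
  fin_cases i
  · exact ⟨0, w, _, hw, Quasi.zero, fun m => by simp⟩
  · exact ⟨0, _, w, Quasi.zero, hw, fun m => by simp⟩

theorem BaseModExact.mul_iterate_pderiv (i : Fin 2) (n : ℕ) (hw : Quasi w)
    (h : ∀ c : Polynomial (MvPolynomial (Fin 2) ℚ),
      BaseModExact (fun m => c.eval (MvPolynomial.C (m : ℚ)) * w m)) :
    Quasi (fun m => (MvPolynomial.pderiv i)^[n] (w m)) ∧
    ∀ c : Polynomial (MvPolynomial (Fin 2) ℚ), BaseModExact
      (fun m => c.eval (MvPolynomial.C (m : ℚ)) * (MvPolynomial.pderiv i)^[n] (w m)) := by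
  induction n with
  | zero => exact ⟨hw, h⟩
  | succ n ih =>
    obtain ⟨hq, hb⟩ := ih
    simp only [Function.iterate_succ_apply']
    refine ⟨hq.pderiv i, fun c => ?_⟩
    obtain ⟨D, hD⟩ := exists_coeff_pderiv i c
    convert (BaseModExact.pderiv i (hq.mul c)).add (hb (-D)) using 2 with m
    rw [Derivation.leibniz, Polynomial.eval_neg, (hD m).1]
    simp only [smul_eq_mul]
    ring

theorem InDModule.quasi_and_baseModExact (h : InDModule quartic (MvPolynomial.X 0) w) :
    Quasi w ∧ BaseModExact w := by
  refine InDModule.induction (P := fun w => Quasi w ∧ BaseModExact w)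
    ⟨Quasi.zero, 0, _, _, Quasi.zero, Quasi.zero, by simp⟩
    (fun v w hv hw => ⟨hv.1.add hw.1, hv.2.add hw.2⟩) (fun α c => ?_) h
  simp only [pdIter_fin_two]
  have h1 := BaseModExact.mul_iterate_pderiv 1 (α 1) Quasi.base
    fun c => ⟨c, _, _, Quasi.zero, Quasi.zero, by simp⟩
  have h0 := BaseModExact.mul_iterate_pderiv 0 (α 0) h1.1 h1.2
  exact ⟨h0.1.mul c, h0.2 c⟩

end QuasiPolynomial

theorem quartic_ne_zero : quartic ≠ 0 := by
  intro h
  have := congrArg (MvPolynomial.eval (fun _ => (1 : ℚ))) h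
  norm_num [quartic] at this

theorem eq_of_eval_natCast_eq {p q : Polynomial (MvPolynomial (Fin 2) ℚ)}
    (h : ∀ m : ℕ, p.eval (MvPolynomial.C (m : ℚ)) = q.eval (MvPolynomial.C (m : ℚ))) : p = q := by
  refine Polynomial.eq_of_infinite_eval_eq p q (Set.Infinite.mono ?_
    (Set.infinite_range_of_injective
      (f := fun m : ℕ => (MvPolynomial.C (m : ℚ) : MvPolynomial (Fin 2) ℚ)) ?_))
  · rintro _ ⟨m, rfl⟩
    exact h m
  · intro a b hab
    exact_mod_cast MvPolynomial.C_injective _ _ hab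

theorem inDModule_of_satisfiesBS {f g : MvPolynomial (Fin 2) ℚ} {b : Polynomial ℚ}
    (h : SatisfiesBS f g b) :
    InDModule f g (fun m => MvPolynomial.C (b.eval (m : ℚ)) * g * f ^ m) := by
  classical
  obtain ⟨A, p, hp⟩ := h
  simp only [hp]
  clear hp
  induction A using Finset.induction_on with
  | empty => simpa using InDModule.zero
  | insert α A hα ih =>
    simp only [Finset.sum_insert hα]
    simpa only [map_natCast] using (InDModule.single α (p α)).add ih

section Roots

variable {b : Polynomial ℚ}

theorem eval_neg_two_eq_zero (h : SatisfiesBS quartic (MvPolynomial.X 0) b) :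
    b.eval (-2) = 0 := by
  obtain ⟨K, Q, hQ, -, h2⟩ := (inDModule_of_satisfiesBS h).quasi_and_baseModExact.1
  have hQ' : Q = b.map MvPolynomial.C * Polynomial.C (MvPolynomial.X 0 * quartic ^ K) := by
    refine eq_of_eval_natCast_eq fun m => mul_right_cancel₀ (pow_ne_zero m quartic_ne_zero) ?_
    rw [← hQ, Polynomial.eval_mul, Polynomial.eval_C, Polynomial.eval_map_apply]
    ring
  rw [hQ', Polynomial.eval_mul, Polynomial.eval_C, Polynomial.eval_map_apply, quartic_eq] at h2
  obtain ⟨g, hg⟩ := h2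
  have hg' : MvPolynomial.C (b.eval (-2)) * cubicForm ^ K = MvPolynomial.X 0 * g := by
    refine mul_left_cancel₀ (pow_ne_zero (K + 1) (MvPolynomial.X_ne_zero (0 : Fin 2))) ?_
    linear_combination hg
  simpa [cubicForm] using congrArg (MvPolynomial.eval ![(0 : ℚ), 1]) hg'

theorem exists_twisted_exact (h : SatisfiesBS quartic (MvPolynomial.X 0) b) (j : ℕ) :
    ∃ (K : ℕ) (r U V DU DV : Polynomial (MvPolynomial (Fin 2) ℚ)),
      quartic ^ (K + 1) ∣ U.eval (MvPolynomial.C (-1)) ∧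
      quartic ^ (K + 1) ∣ V.eval (MvPolynomial.C (-1)) ∧
      (∀ a : ℚ, DU.eval (MvPolynomial.C a) = pderiv 0 (U.eval (MvPolynomial.C a)) ∧
        (derivative DU).eval (MvPolynomial.C a) =
          pderiv 0 ((derivative U).eval (MvPolynomial.C a))) ∧
      (∀ a : ℚ, DV.eval (MvPolynomial.C a) = pderiv 1 (V.eval (MvPolynomial.C a)) ∧
        (derivative DV).eval (MvPolynomial.C a) =
          pderiv 1 ((derivative V).eval (MvPolynomial.C a))) ∧
      b.map MvPolynomial.C * Polynomial.C (MvPolynomial.X 0 ^ (j + 1) * quartic ^ (K + 1)) =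
        r * Polynomial.C (MvPolynomial.X 0 * quartic ^ (K + 2)) +
        (Polynomial.C quartic * DU + (Polynomial.X - Polynomial.C (MvPolynomial.C (K : ℚ))) *
          (Polynomial.C (pderiv 0 quartic) * U)) +
        (Polynomial.C quartic * DV + (Polynomial.X - Polynomial.C (MvPolynomial.C (K : ℚ))) *
          (Polynomial.C (pderiv 1 quartic) * V)) := by
  obtain ⟨r, u, v, ⟨K, hu⟩, ⟨L, hv⟩, hw⟩ := ((inDModule_of_satisfiesBS h).mul
    (Polynomial.C (MvPolynomial.X 0 ^ j))).quasi_and_baseModExact.2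
  obtain ⟨U, hU, hU1, -⟩ := hu.mono (le_max_left K L)
  obtain ⟨V, hV, hV1, -⟩ := hv.mono (le_max_right K L)
  obtain ⟨DU, hDU⟩ := exists_coeff_pderiv 0 U
  obtain ⟨DV, hDV⟩ := exists_coeff_pderiv 1 V
  refine ⟨max K L, r, U, V, DU, DV, hU1, hV1, hDU, hDV, ?_⟩
  generalize max K L = N at *
  refine eq_of_eval_natCast_eq fun m => mul_right_cancel₀ (pow_ne_zero m quartic_ne_zero) ?_
  have hwm := hw m
  simp only [Polynomial.eval_C] at hwm
  have h0 := pow_mul_pderiv (i := 0) (hU m)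
  have h1 := pow_mul_pderiv (i := 1) (hV m)
  simp only [Polynomial.eval_add, Polynomial.eval_sub, Polynomial.eval_mul, Polynomial.eval_C,
    Polynomial.eval_X, Polynomial.eval_map_apply, (hDU _).1, (hDV _).1]
  rw [map_sub] at h0 h1
  linear_combination quartic ^ (N + 1) * hwm + h0 + h1

theorem eval_eq_zero (h : SatisfiesBS quartic (MvPolynomial.X 0) b) {j : ℕ} (hj : j ≤ 4) {σ : ℚ}
    (hσ : 4 * σ + 3 + j = 0) : b.eval σ = 0 := by
  obtain ⟨K, r, U, V, DU, DV, -, -, hDU, hDV, heq⟩ := exists_twisted_exact h j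
  refine eq_zero_of_twisted_exact (K := K) (r := r.eval (MvPolynomial.C σ))
    (U := U.eval (MvPolynomial.C σ)) (V := V.eval (MvPolynomial.C σ)) (E := 0) hj hσ
    (by simp [dehom]) ?_
  have heq := congrArg (Polynomial.eval (MvPolynomial.C σ)) heq
  simpa only [Polynomial.eval_add, Polynomial.eval_sub, Polynomial.eval_mul, Polynomial.eval_C,
    Polynomial.eval_X, Polynomial.eval_map_apply, (hDU _).1, (hDV _).1, ← map_sub,
    add_zero] using heq

theorem eval_derivative_neg_one_eq_zero (h : SatisfiesBS quartic (MvPolynomial.X 0) b) :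
    (derivative b).eval (-1) = 0 := by
  obtain ⟨K, r, U, V, DU, DV, hU, hV, hDU, hDV, heq⟩ := exists_twisted_exact h 1
  refine eq_zero_of_twisted_exact (K := K) (j := 1) (σ := -1)
    (r := (derivative r).eval (MvPolynomial.C (-1)))
    (U := (derivative U).eval (MvPolynomial.C (-1)))
    (V := (derivative V).eval (MvPolynomial.C (-1)))
    (E := pderiv 0 quartic * U.eval (MvPolynomial.C (-1)) +
      pderiv 1 quartic * V.eval (MvPolynomial.C (-1))) (by norm_num) (by norm_num) ?_ ?_
  · obtain ⟨g, hg⟩ := hU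
    obtain ⟨g', hg'⟩ := hV
    have hpow : blowup (quartic ^ (K + 1)) =
        Polynomial.C (cubic ^ (K + 1)) * Polynomial.X ^ (4 * (K + 1)) := by
      rw [map_pow, blowup_quartic, mul_pow, ← pow_mul, map_pow]
    rw [hg, hg', dehom_add, show 4 * K + 5 + 1 = 4 * K + 3 + 3 by omega,
      dehom_mul_of_blowup_eq blowup_pderiv_zero_quartic,
      dehom_mul_of_blowup_eq blowup_pderiv_one_quartic,
      dehom_mul_of_blowup_eq_of_lt hpow (by omega),
      dehom_mul_of_blowup_eq_of_lt hpow (by omega)]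
    simp
  · have heq := congrArg (fun p => (derivative p).eval (MvPolynomial.C (-1))) heq
    simp only [derivative_add, derivative_mul, derivative_sub, derivative_C, derivative_X,
      derivative_map, Polynomial.eval_add, Polynomial.eval_sub, Polynomial.eval_mul,
      Polynomial.eval_C, Polynomial.eval_X, Polynomial.eval_map_apply, Polynomial.eval_one,
      Polynomial.eval_zero, (hDU _).2, (hDV _).2, ← map_sub] at heq
    linear_combination heq

theorem dvd_of_satisfiesBS (h : SatisfiesBS quartic (MvPolynomial.X 0) b) :
    (Polynomial.X + Polynomial.C (3 / 4 : ℚ)) *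
      (Polynomial.X + Polynomial.C (1 : ℚ)) ^ 2 *
      (Polynomial.X + Polynomial.C (5 / 4 : ℚ)) *
      (Polynomial.X + Polynomial.C (3 / 2 : ℚ)) *
      (Polynomial.X + Polynomial.C (7 / 4 : ℚ)) *
      (Polynomial.X + Polynomial.C (2 : ℚ)) ∣ b := by
  have hroot (a : ℚ) (ha : b.eval (-a) = 0) : Polynomial.X + Polynomial.C a ∣ b := by
    rw [← sub_neg_eq_add, ← map_neg]
    exact Polynomial.dvd_iff_isRoot.mpr ha
  have hcop (a c : ℚ) (hac : a ≠ c) :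
      IsCoprime (Polynomial.X + Polynomial.C a) (Polynomial.X + Polynomial.C c) := by
    have := Polynomial.isCoprime_X_sub_C_of_isUnit_sub (a := -a) (b := -c)
      (isUnit_iff_ne_zero.mpr (by rwa [ne_eq, neg_sub_neg, sub_eq_zero, eq_comm]))
    simpa using this
  have h34 := hroot (3 / 4) (eval_eq_zero h (j := 0) (by norm_num) (by norm_num))
  have h54 := hroot (5 / 4) (eval_eq_zero h (j := 2) (by norm_num) (by norm_num))
  have h32 := hroot (3 / 2) (eval_eq_zero h (j := 3) (by norm_num) (by norm_num))
  have h74 := hroot (7 / 4) (eval_eq_zero h (j := 4) (by norm_num) (by norm_num))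
  have h2 := hroot 2 (eval_neg_two_eq_zero h)
  have h1 : (Polynomial.X + Polynomial.C (1 : ℚ)) ^ 2 ∣ b := by
    obtain ⟨e, he⟩ := hroot 1 (eval_eq_zero h (j := 1) (by norm_num) (by norm_num))
    have hd := eval_derivative_neg_one_eq_zero h
    have hee : e.eval (-1) = 0 := by
      rw [he] at hd
      simpa using hd
    rw [he, pow_two, ← sub_neg_eq_add, ← map_neg]
    exact mul_dvd_mul_left _ (Polynomial.dvd_iff_isRoot.mpr hee)
  refine IsCoprime.mul_dvd ?_ (IsCoprime.mul_dvd ?_ (IsCoprime.mul_dvd ?_ (IsCoprime.mul_dvd ?_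
    (IsCoprime.mul_dvd ?_ h34 h1) h54) h32) h74) h2
  all_goals simp only [IsCoprime.mul_left_iff, IsCoprime.pow_left_iff two_pos,
    IsCoprime.pow_right_iff two_pos]
  all_goals repeat' apply And.intro
  all_goals exact hcop _ _ (by norm_num)

end Roots

end BernsteinSato

theorem bernsteinSato_stmt_16 :
    ∀ b : Polynomial ℚ,
      SatisfiesBS (X 0 * X 1 * (X 0 + X 1) * (X 0 + 2 * X 1) : MvPolynomial (Fin 2) ℚ)
          (X 0) b ↔
        (Polynomial.X + Polynomial.C (3 / 4 : ℚ)) *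
            (Polynomial.X + Polynomial.C (1 : ℚ)) ^ 2 *
            (Polynomial.X + Polynomial.C (5 / 4 : ℚ)) *
            (Polynomial.X + Polynomial.C (3 / 2 : ℚ)) *
            (Polynomial.X + Polynomial.C (7 / 4 : ℚ)) *
            (Polynomial.X + Polynomial.C (2 : ℚ)) ∣ b := by
  exact fun b => ⟨BernsteinSato.dvd_of_satisfiesBS, BernsteinSato.satisfiesBS_of_dvd⟩
end

section
/- Let f = x·y·(x+y)·(x+2y) and g = x² in ℚ[x,y]. For every b ∈ ℚ[s], b satisfies the Bernstein–Sato functional equation for the pair (f, g) if and only if (s + 1)²(s + 5/4)(s + 3/2)(s + 7/4)(s + 2)(s + 3) divides b in ℚ[s]; that is, b_{f,x²}(s) = (s + 1)²(s + 5/4)(s + 3/2)(s + 7/4)(s + 2)(s + 3). -/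
open MvPolynomial Polynomial

section Families

variable {σ : Type*}

/-- Differentiation of the coefficients of a polynomial in `s` with respect to `x_i`. -/
noncomputable def coeffDeriv (i : σ) :
    Polynomial (MvPolynomial σ ℚ) →+ Polynomial (MvPolynomial σ ℚ) where
  toFun p := p.sum fun n a => Polynomial.monomial n (MvPolynomial.pderiv i a)
  map_zero' := by simp
  map_add' p q := Polynomial.sum_add_index p q _ (by simp) (by simp)

theorem coeffDeriv_monomial (i : σ) (n : ℕ) (a : MvPolynomial σ ℚ) :
    coeffDeriv i (Polynomial.monomial n a) = Polynomial.monomial n (MvPolynomial.pderiv i a) := by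
  simp [coeffDeriv]

theorem eval_coeffDeriv (i : σ) (p : Polynomial (MvPolynomial σ ℚ)) (c : ℚ) :
    Polynomial.eval (MvPolynomial.C c) (coeffDeriv i p) =
      MvPolynomial.pderiv i (Polynomial.eval (MvPolynomial.C c) p) := by
  induction p using Polynomial.induction_on' with
  | add p q hp hq => simp [hp, hq]
  | monomial n a =>
    rw [coeffDeriv_monomial, Polynomial.eval_monomial, Polynomial.eval_monomial,
      ← map_pow, mul_comm, mul_comm a, MvPolynomial.pderiv_C_mul]

theorem eval_natCast_coeffDeriv (i : σ) (p : Polynomial (MvPolynomial σ ℚ)) (m : ℕ) :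
    Polynomial.eval (m : MvPolynomial σ ℚ) (coeffDeriv i p) =
      MvPolynomial.pderiv i (Polynomial.eval (m : MvPolynomial σ ℚ) p) := by
  simpa using eval_coeffDeriv i p m

theorem derivative_coeffDeriv (i : σ) (p : Polynomial (MvPolynomial σ ℚ)) :
    Polynomial.derivative (coeffDeriv i p) = coeffDeriv i (Polynomial.derivative p) := by
  induction p using Polynomial.induction_on' with
  | add p q hp hq => simp [hp, hq]
  | monomial n a =>
    rw [coeffDeriv_monomial, Polynomial.derivative_monomial, Polynomial.derivative_monomial,
      coeffDeriv_monomial]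
    simp [mul_comm]

theorem pderiv_commute (i j : σ) :
    Function.Commute (MvPolynomial.pderiv (R := ℚ) i) (MvPolynomial.pderiv (R := ℚ) j) := by
  classical
  intro p
  have h : ⁅MvPolynomial.pderiv (R := ℚ) i, MvPolynomial.pderiv (R := ℚ) j⁆ = 0 := by
    refine MvPolynomial.derivation_ext fun k => ?_
    simp [Derivation.commutator_apply, MvPolynomial.pderiv_X, Pi.single_apply, apply_ite]
  have := congrArg (fun D => D p) h
  simpa [Derivation.commutator_apply, sub_eq_zero] using this

theorem mul_pderiv_pow (f : MvPolynomial σ ℚ) (i : σ) (n : ℕ) :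
    f * MvPolynomial.pderiv i (f ^ n) = n * f ^ n * MvPolynomial.pderiv i f := by
  cases n with
  | zero => simp
  | succ n => rw [MvPolynomial.pderiv_pow, Nat.add_sub_cancel]; ring

theorem eval_natCast_map_C (b : Polynomial ℚ) (m : ℕ) :
    Polynomial.eval (m : MvPolynomial σ ℚ) (b.map MvPolynomial.C) =
      MvPolynomial.C (Polynomial.eval (m : ℚ) b) := by
  rw [← map_natCast (MvPolynomial.C : ℚ →+* MvPolynomial σ ℚ) m, Polynomial.eval_map_apply]

variable [Fintype σ]

theorem forall_mul_pdIter_of_closed {Q : (ℕ → MvPolynomial σ ℚ) → Prop}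
    (hadd : ∀ F G, Q F → Q G → Q (fun m => F m + G m))
    (hder : ∀ i F, Q F → Q (fun m => MvPolynomial.pderiv i (F m)))
    {w : ℕ → MvPolynomial σ ℚ}
    (hw : ∀ p : Polynomial (MvPolynomial σ ℚ),
      Q (fun m => Polynomial.eval (m : MvPolynomial σ ℚ) p * w m)) (α : σ → ℕ) :
    ∀ p : Polynomial (MvPolynomial σ ℚ),
      Q (fun m => Polynomial.eval (m : MvPolynomial σ ℚ) p * pdIter α (w m)) := by
  have step : ∀ (i : σ) (G : ℕ → MvPolynomial σ ℚ),
      (∀ p : Polynomial (MvPolynomial σ ℚ),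
        Q (fun m => Polynomial.eval (m : MvPolynomial σ ℚ) p * G m)) →
      ∀ p : Polynomial (MvPolynomial σ ℚ),
        Q (fun m => Polynomial.eval (m : MvPolynomial σ ℚ) p * MvPolynomial.pderiv i (G m)) := by
    intro i G hG p
    convert hadd _ _ (hder i _ (hG p)) (hG (-coeffDeriv i p)) using 2 with m
    rw [Polynomial.eval_neg, eval_natCast_coeffDeriv, MvPolynomial.pderiv_mul]
    ring
  have iter : ∀ (i : σ) (n : ℕ) (G : ℕ → MvPolynomial σ ℚ),
      (∀ p : Polynomial (MvPolynomial σ ℚ),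
        Q (fun m => Polynomial.eval (m : MvPolynomial σ ℚ) p * G m)) →
      ∀ p : Polynomial (MvPolynomial σ ℚ),
        Q (fun m => Polynomial.eval (m : MvPolynomial σ ℚ) p *
          (⇑(MvPolynomial.pderiv i))^[n] (G m)) := by
    intro i n
    induction n with
    | zero => exact fun G hG => hG
    | succ n ih =>
      intro G hG
      simp only [Function.iterate_succ, Function.comp_apply]
      exact ih _ (step i G hG)
  unfold pdIter
  generalize (Finset.univ : Finset σ).toList = l
  induction l generalizing w with
  | nil => exact hw
  | cons i l ih =>
    simp only [List.foldl_cons]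
    exact ih (iter i (α i) w hw)

/-- The families `m ↦ ∑ p_α(m) ∂^α (w m)`, i.e. the elements of `D[s] · w`. -/
def MemDSpan (w F : ℕ → MvPolynomial σ ℚ) : Prop :=
  ∃ (A : Finset (σ → ℕ)) (p : (σ → ℕ) → Polynomial (MvPolynomial σ ℚ)),
    ∀ m : ℕ, F m = ∑ α ∈ A, Polynomial.eval (m : MvPolynomial σ ℚ) (p α) * pdIter α (w m)

variable {w F G : ℕ → MvPolynomial σ ℚ}

theorem MemDSpan.add (hF : MemDSpan w F) (hG : MemDSpan w G) :
    MemDSpan w (fun m => F m + G m) := by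
  classical
  obtain ⟨A, p, hp⟩ := hF
  obtain ⟨B, q, hq⟩ := hG
  refine ⟨A ∪ B, fun α => (if α ∈ A then p α else 0) + (if α ∈ B then q α else 0), fun m => ?_⟩
  simp only [hp, hq, Polynomial.eval_add, add_mul, Finset.sum_add_distrib,
    apply_ite (Polynomial.eval (m : MvPolynomial σ ℚ)), Polynomial.eval_zero, ite_mul, zero_mul,
    Finset.sum_ite_mem, Finset.union_inter_cancel_left, Finset.union_inter_cancel_right]

theorem MemDSpan.zero : MemDSpan w (fun _ => 0) :=
  ⟨∅, 0, by simp⟩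

theorem MemDSpan.mul (hF : MemDSpan w F) (r : Polynomial (MvPolynomial σ ℚ)) :
    MemDSpan w (fun m => Polynomial.eval (m : MvPolynomial σ ℚ) r * F m) := by
  obtain ⟨A, p, hp⟩ := hF
  refine ⟨A, fun α => r * p α, fun m => ?_⟩
  simp only [hp, Finset.mul_sum, Polynomial.eval_mul, mul_assoc]

theorem MemDSpan.single (p : Polynomial (MvPolynomial σ ℚ)) (α : σ → ℕ) :
    MemDSpan w (fun m => Polynomial.eval (m : MvPolynomial σ ℚ) p * pdIter α (w m)) :=
  ⟨{α}, fun _ => p, fun _ => by simp⟩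

theorem pdIter_zero (p : MvPolynomial σ ℚ) : pdIter 0 p = p := by
  unfold pdIter
  generalize (Finset.univ : Finset σ).toList = l
  induction l with
  | nil => rfl
  | cons i l ih => exact ih

theorem pderiv_pdIter [DecidableEq σ] (i : σ) (α : σ → ℕ) (p : MvPolynomial σ ℚ) :
    MvPolynomial.pderiv i (pdIter α p) = pdIter (α + Pi.single i 1) p := by
  have comm : ∀ (l : List σ) (β : σ → ℕ) (q : MvPolynomial σ ℚ),
      MvPolynomial.pderiv i (l.foldl (fun q j => (⇑(MvPolynomial.pderiv j))^[β j] q) q) =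
        l.foldl (fun q j => (⇑(MvPolynomial.pderiv j))^[β j] q) (MvPolynomial.pderiv i q) := by
    intro l β
    induction l with
    | nil => exact fun q => rfl
    | cons j l ih =>
      intro q
      rw [List.foldl_cons, List.foldl_cons, ih, ((pderiv_commute i j).iterate_right (β j)) q]
  have key : ∀ l : List σ, l.Nodup → i ∈ l → ∀ q : MvPolynomial σ ℚ,
      l.foldl (fun q j => (⇑(MvPolynomial.pderiv j))^[(α + Pi.single i 1 : σ → ℕ) j] q) q =
        l.foldl (fun q j => (⇑(MvPolynomial.pderiv j))^[α j] q) (MvPolynomial.pderiv i q) := by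
    intro l
    induction l with
    | nil => simp
    | cons j l ih =>
      intro hl hi q
      rw [List.nodup_cons] at hl
      rw [List.foldl_cons, List.foldl_cons]
      by_cases hij : i = j
      · subst hij
        have : ∀ q : MvPolynomial σ ℚ,
            l.foldl (fun q j => (⇑(MvPolynomial.pderiv j))^[(α + Pi.single i 1 : σ → ℕ) j] q) q =
            l.foldl (fun q j => (⇑(MvPolynomial.pderiv j))^[α j] q) q := by
          intro q
          refine List.foldl_ext _ _ _ fun q j hj => ?_
          have hne : j ≠ i := fun h => hl.1 (h ▸ hj)
          simp [hne]
        rw [this]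
        simp
      · have hj : (α + Pi.single i 1 : σ → ℕ) j = α j := by simp [Ne.symm hij]
        rw [ih hl.2 ((List.mem_cons.1 hi).resolve_left hij), hj,
          ((pderiv_commute i j).iterate_right (α j)) q]
  unfold pdIter
  rw [comm, key _ (Finset.nodup_toList _) (by simp)]

theorem MemDSpan.self : MemDSpan w w := by
  simpa [pdIter_zero] using MemDSpan.single (w := w) 1 0

theorem MemDSpan.pderiv (hF : MemDSpan w F) (i : σ) :
    MemDSpan w (fun m => MvPolynomial.pderiv i (F m)) := by
  classical
  obtain ⟨A, p, hp⟩ := hF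
  simp only [hp, map_sum]
  clear hp
  induction A using Finset.induction_on with
  | empty => simpa using MemDSpan.zero
  | insert α A hα ih =>
    simp only [Finset.sum_insert hα]
    refine MemDSpan.add ?_ ih
    simp only [MvPolynomial.pderiv_mul, ← eval_natCast_coeffDeriv, pderiv_pdIter]
    exact (MemDSpan.single (coeffDeriv i (p α)) α).add (MemDSpan.single _ _)

/-- The ideal of all `q ∈ R[s]` with `q(s) g f^s ∈ D[s] · g f^(s + 1)`. -/
noncomputable def bernsteinIdeal (f g : MvPolynomial σ ℚ) :
    Ideal (Polynomial (MvPolynomial σ ℚ)) where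
  carrier := {q | MemDSpan (fun m => g * f ^ (m + 1))
    (fun m => Polynomial.eval (m : MvPolynomial σ ℚ) q * (g * f ^ m))}
  add_mem' {p q} hp hq := by
    change MemDSpan _ _
    simpa only [Polynomial.eval_add, add_mul] using MemDSpan.add hp hq
  zero_mem' := by simpa using MemDSpan.zero
  smul_mem' r q hq := by
    change MemDSpan _ _
    simpa only [smul_eq_mul, Polynomial.eval_mul, mul_assoc] using MemDSpan.mul hq r

theorem map_C_mem_bernsteinIdeal_iff {f g : MvPolynomial σ ℚ} {b : Polynomial ℚ} :
    b.map MvPolynomial.C ∈ bernsteinIdeal f g ↔ SatisfiesBS f g b := by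
  change MemDSpan _ _ ↔ MemDSpan _ _
  simp only [eval_natCast_map_C, mul_assoc]

/-- A system of conditions on pairs `(N, v)`, thought of as elements `v f^(s - N)`, which is
stable under the action of `D[s]` and holds on `R[s] g f^(s + 1)`, also holds for
`b(s) φ g f^s` whenever `b` satisfies the functional equation. -/
theorem SatisfiesBS.exists_of_closed {f g : MvPolynomial σ ℚ} {b : Polynomial ℚ}
    (hb : SatisfiesBS f g b) (hf : f ≠ 0)
    {P : ℕ → Polynomial (MvPolynomial σ ℚ) → Prop}
    (hadd : ∀ N u v, P N u → P N v → P N (u + v))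
    (hshift : ∀ N v, P N v → P (N + 1) (Polynomial.C f * v))
    (hder : ∀ N i v, P N v → P (N + 1) (Polynomial.C f * coeffDeriv i v +
      (Polynomial.X - Polynomial.C (N : MvPolynomial σ ℚ)) * v *
        Polynomial.C (MvPolynomial.pderiv i f)))
    (hbase : ∀ p, P 0 (p * Polynomial.C (g * f)))
    (φ : MvPolynomial σ ℚ) :
    ∃ N, P N (b.map MvPolynomial.C * Polynomial.C (φ * g * f ^ N)) := by
  have hshift' : ∀ k N v, P N v → P (N + k) (Polynomial.C f ^ k * v) := by
    intro k
    induction k with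
    | zero => simp
    | succ k ih =>
      intro N v h
      have := hshift _ _ (ih N v h)
      rwa [← mul_assoc, ← pow_succ'] at this
  let Q : (ℕ → MvPolynomial σ ℚ) → Prop := fun F =>
    ∃ N v, (∀ m : ℕ, F m * f ^ N = Polynomial.eval (m : MvPolynomial σ ℚ) v * f ^ m) ∧ P N v
  have hQadd : ∀ F G, Q F → Q G → Q (fun m => F m + G m) := by
    rintro F G ⟨N, u, hu, hPu⟩ ⟨M, v, hv, hPv⟩
    refine ⟨N + M, Polynomial.C f ^ M * u + Polynomial.C f ^ N * v, fun m => ?_,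
      hadd _ _ _ (hshift' M N u hPu) (by rw [add_comm]; exact hshift' N M v hPv)⟩
    simp only [Polynomial.eval_add, Polynomial.eval_mul, Polynomial.eval_pow, Polynomial.eval_C]
    linear_combination f ^ M * hu m + f ^ N * hv m
  have hQder : ∀ i F, Q F → Q (fun m => MvPolynomial.pderiv i (F m)) := by
    rintro i F ⟨N, v, hv, hPv⟩
    refine ⟨N + 1, _, fun m => ?_, hder N i v hPv⟩
    have h := congrArg (MvPolynomial.pderiv i) (hv m)
    rw [MvPolynomial.pderiv_mul, MvPolynomial.pderiv_mul] at h
    simp only [Polynomial.eval_add, Polynomial.eval_sub, Polynomial.eval_mul, Polynomial.eval_X,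
      Polynomial.eval_C, eval_natCast_coeffDeriv]
    linear_combination f * h - F m * mul_pderiv_pow f i N +
      Polynomial.eval (m : MvPolynomial σ ℚ) v * mul_pderiv_pow f i m -
      N * MvPolynomial.pderiv i f * hv m
  have hQw : ∀ p : Polynomial (MvPolynomial σ ℚ),
      Q (fun m => Polynomial.eval (m : MvPolynomial σ ℚ) p * (g * f ^ (m + 1))) := fun p =>
    ⟨0, _, fun m => by simp only [Polynomial.eval_mul, Polynomial.eval_C]; ring, hbase p⟩
  have hQ0 : Q (fun _ => 0) := by simpa using hQw 0
  obtain ⟨A, p, hp⟩ := hb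
  have hQb : Q (fun m => φ * (MvPolynomial.C (Polynomial.eval (m : ℚ) b) * g * f ^ m)) := by
    have key : ∀ B : Finset (σ → ℕ), Q (fun m => ∑ α ∈ B,
        Polynomial.eval (m : MvPolynomial σ ℚ) (Polynomial.C φ * p α) *
          pdIter α (g * f ^ (m + 1))) := by
      classical
      intro B
      induction B using Finset.induction_on with
      | empty => simpa using hQ0
      | insert α B hα ih =>
        simp only [Finset.sum_insert hα]
        exact hQadd _ _ (forall_mul_pdIter_of_closed hQadd hQder hQw α _) ih
    convert key A using 2 with m
    simp only [hp, Finset.mul_sum, Polynomial.eval_mul, Polynomial.eval_C, mul_assoc]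
  obtain ⟨N, v, hv, hPv⟩ := hQb
  refine ⟨N, ?_⟩
  suffices h : b.map MvPolynomial.C * Polynomial.C (φ * g * f ^ N) = v by rwa [h]
  refine Polynomial.eq_of_infinite_eval_eq _ _ ?_
  refine Set.Infinite.mono (s := Set.range ((↑) : ℕ → MvPolynomial σ ℚ)) ?_
    (Set.infinite_range_of_injective Nat.cast_injective)
  rintro _ ⟨m, rfl⟩
  refine mul_right_cancel₀ (pow_ne_zero m hf) ?_
  simp only [Polynomial.eval_mul, Polynomial.eval_C, eval_natCast_map_C]
  rw [← hv m]
  ring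

end Families

/-- The arrangement `x y (x + y) (x + 2 y)` of four lines through the origin. -/
noncomputable def fourLines : MvPolynomial (Fin 2) ℚ :=
  MvPolynomial.X 0 * MvPolynomial.X 1 * (MvPolynomial.X 0 + MvPolynomial.X 1) *
    (MvPolynomial.X 0 + 2 * MvPolynomial.X 1)

theorem fourLines_ne_zero : fourLines ≠ 0 := by
  intro h
  have := congrArg (MvPolynomial.eval fun _ => (1 : ℚ)) h
  norm_num [fourLines] at this

section UpperBound

theorem pderiv_two (i : Fin 2) : MvPolynomial.pderiv i (2 : MvPolynomial (Fin 2) ℚ) = 0 :=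
  (MvPolynomial.pderiv i).map_natCast 2

theorem pderiv_zero_fourLines : MvPolynomial.pderiv 0 fourLines =
    MvPolynomial.X 1 * (3 * MvPolynomial.X 0 ^ 2 + 6 * MvPolynomial.X 0 * MvPolynomial.X 1 +
      2 * MvPolynomial.X 1 ^ 2) := by
  simp only [fourLines, MvPolynomial.pderiv_mul, map_add, MvPolynomial.pderiv_X_self, pderiv_two,
    MvPolynomial.pderiv_X_of_ne (R := ℚ) (show (1 : Fin 2) ≠ 0 by decide)]
  ring

theorem pderiv_one_fourLines : MvPolynomial.pderiv 1 fourLines =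
    MvPolynomial.X 0 * (MvPolynomial.X 0 ^ 2 + 6 * MvPolynomial.X 0 * MvPolynomial.X 1 +
      6 * MvPolynomial.X 1 ^ 2) := by
  simp only [fourLines, MvPolynomial.pderiv_mul, map_add, MvPolynomial.pderiv_X_self, pderiv_two,
    MvPolynomial.pderiv_X_of_ne (R := ℚ) (show (0 : Fin 2) ≠ 1 by decide)]
  ring

theorem C_mem_bernsteinIdeal {σ : Type*} [Fintype σ] (f g : MvPolynomial σ ℚ) :
    Polynomial.C f ∈ bernsteinIdeal f g := by
  change MemDSpan _ _
  convert MemDSpan.self (w := fun m => g * f ^ (m + 1)) using 2 with m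
  rw [Polynomial.eval_C]
  ring

theorem pderiv_zero_relation_mem :
    (Polynomial.X + 3) * Polynomial.C (MvPolynomial.X 1 * (MvPolynomial.X 0 + MvPolynomial.X 1) *
        (MvPolynomial.X 0 + 2 * MvPolynomial.X 1)) +
      (Polynomial.X + 1) * Polynomial.C (MvPolynomial.X 0 * MvPolynomial.X 1 *
        (2 * MvPolynomial.X 0 + 3 * MvPolynomial.X 1)) ∈
      bernsteinIdeal fourLines (MvPolynomial.X 0 ^ 2) := by
  change MemDSpan _ _
  convert MemDSpan.pderiv (MemDSpan.self
    (w := fun m => MvPolynomial.X 0 ^ 2 * fourLines ^ (m + 1))) 0 using 2 with m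
  rw [MvPolynomial.pderiv_mul, MvPolynomial.pderiv_pow, MvPolynomial.pderiv_pow,
    pderiv_zero_fourLines, MvPolynomial.pderiv_X_self]
  simp only [Polynomial.eval_add, Polynomial.eval_mul, Polynomial.eval_X, Polynomial.eval_C,
    Polynomial.eval_ofNat, Polynomial.eval_one, Nat.add_sub_cancel, pow_succ fourLines m]
  rw [fourLines]
  push_cast
  ring

theorem pderiv_one_relation_mem :
    (Polynomial.X + 1) * Polynomial.C (MvPolynomial.X 0 * (MvPolynomial.X 0 ^ 2 +
        6 * MvPolynomial.X 0 * MvPolynomial.X 1 + 6 * MvPolynomial.X 1 ^ 2)) ∈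
      bernsteinIdeal fourLines (MvPolynomial.X 0 ^ 2) := by
  change MemDSpan _ _
  convert MemDSpan.pderiv (MemDSpan.self
    (w := fun m => MvPolynomial.X 0 ^ 2 * fourLines ^ (m + 1))) 1 using 2 with m
  rw [MvPolynomial.pderiv_mul, MvPolynomial.pderiv_pow, MvPolynomial.pderiv_pow,
    pderiv_one_fourLines, MvPolynomial.pderiv_X_of_ne (R := ℚ) (show (0 : Fin 2) ≠ 1 by decide)]
  simp only [Polynomial.eval_add, Polynomial.eval_mul, Polynomial.eval_X, Polynomial.eval_C,
    Polynomial.eval_one, Nat.add_sub_cancel]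
  push_cast
  ring

theorem mem_of_natCast_mul_mem {σ : Type*} {J : Ideal (Polynomial (MvPolynomial σ ℚ))}
    {q : Polynomial (MvPolynomial σ ℚ)} {n : ℕ} (hn : n ≠ 0) (h : n * q ∈ J) : q ∈ J := by
  have hu : IsUnit ((n : ℚ) : ℚ) := by simpa using hn
  have := hu.map ((Polynomial.C : MvPolynomial σ ℚ →+* _).comp MvPolynomial.C)
  rw [map_natCast] at this
  exact (Ideal.unit_mul_mem_iff_mem J this).1 h

theorem quintic_mem : ∀ a b : ℕ, a + b = 5 →
    (Polynomial.X + 1) * (Polynomial.X + 3) *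
      (Polynomial.C (MvPolynomial.X 0) ^ a * Polynomial.C (MvPolynomial.X 1) ^ b) ∈
      bernsteinIdeal fourLines (MvPolynomial.X 0 ^ 2) := by
  have h0 := C_mem_bernsteinIdeal fourLines (MvPolynomial.X 0 ^ 2)
  have h1 := pderiv_zero_relation_mem
  have h2 := pderiv_one_relation_mem
  generalize bernsteinIdeal fourLines (MvPolynomial.X 0 ^ 2) = J at *
  simp only [fourLines, map_add, map_mul, map_pow, Polynomial.C_ofNat] at h0 h1 h2
  generalize Polynomial.C (MvPolynomial.X (0 : Fin 2) : MvPolynomial (Fin 2) ℚ) = x at *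
  generalize Polynomial.C (MvPolynomial.X (1 : Fin 2) : MvPolynomial (Fin 2) ℚ) = y at *
  generalize (Polynomial.X : Polynomial (MvPolynomial (Fin 2) ℚ)) = s at *
  have comb : ∀ α β q, α * (x * (x ^ 2 + 6 * x * y + 6 * y ^ 2)) +
      β * (x * y * (x + y) * (x + 2 * y)) = q → (s + 1) * q ∈ J := by
    rintro α β _ rfl
    convert J.add_mem (J.mul_mem_left α h2) (J.mul_mem_left ((s + 1) * β) h0) using 1
    ring
  have m0 : (s + 1) * (x ^ 5) ∈ J :=
    comb (x ^ 2 + 12 * x * y + 12 * y ^ 2) (-18 * x - 36 * y) _ (by ring)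
  have m1 : (s + 1) * (x ^ 4 * y) ∈ J :=
    comb (-5 * x * y - 6 * y ^ 2) (6 * x + 18 * y) _ (by ring)
  have m2 : (s + 1) * (x ^ 3 * y ^ 2) ∈ J :=
    comb (3 * x * y + 4 * y ^ 2) (-3 * x - 12 * y) _ (by ring)
  have m3 : (s + 1) * (x ^ 2 * y ^ 3) ∈ J :=
    comb (-2 * x * y - 3 * y ^ 2) (2 * x + 9 * y) _ (by ring)
  have m4 : (s + 1) * (x * y ^ 4) ∈ J := by
    refine mem_of_natCast_mul_mem two_ne_zero ?_
    convert comb (3 * x * y + 5 * y ^ 2) (-3 * x - 14 * y) (2 * (x * y ^ 4)) (by ring) using 1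
    push_cast
    ring
  have m5 : (s + 1) * (s + 3) * y ^ 5 ∈ J := by
    refine mem_of_natCast_mul_mem two_ne_zero ?_
    convert J.sub_mem (J.sub_mem (J.mul_mem_left ((s + 1) * y ^ 2) h1)
      (J.mul_mem_left ((s + 3) + 2 * (s + 1)) m3))
      (J.mul_mem_left (3 * (s + 3) + 3 * (s + 1)) m4) using 1
    push_cast
    ring
  intro a b hab
  obtain rfl : a = 5 - b := by lia
  have hb : b ≤ 5 := by lia
  interval_cases b
  · convert J.mul_mem_left (s + 3) m0 using 1; ring
  · convert J.mul_mem_left (s + 3) m1 using 1; ring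
  · convert J.mul_mem_left (s + 3) m2 using 1; ring
  · convert J.mul_mem_left (s + 3) m3 using 1; ring
  · convert J.mul_mem_left (s + 3) m4 using 1; ring
  · convert m5 using 1; ring

theorem euler_fourLines : MvPolynomial.X 0 * MvPolynomial.pderiv 0 fourLines +
    MvPolynomial.X 1 * MvPolynomial.pderiv 1 fourLines = 4 * fourLines := by
  rw [pderiv_zero_fourLines, pderiv_one_fourLines, fourLines]
  ring

/-- Euler's relation lowers the degree of the elements of the Bernstein ideal. -/
theorem euler_mul_mem {c : Polynomial ℚ} {a b : ℕ}
    (hx : c.map MvPolynomial.C *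
      (Polynomial.C (MvPolynomial.X 0) ^ (a + 1) * Polynomial.C (MvPolynomial.X 1) ^ b) ∈
      bernsteinIdeal fourLines (MvPolynomial.X 0 ^ 2))
    (hy : c.map MvPolynomial.C *
      (Polynomial.C (MvPolynomial.X 0) ^ a * Polynomial.C (MvPolynomial.X 1) ^ (b + 1)) ∈
      bernsteinIdeal fourLines (MvPolynomial.X 0 ^ 2)) :
    (c * (Polynomial.C 4 * Polynomial.X + Polynomial.C (a + b + 4 : ℚ))).map MvPolynomial.C *
      (Polynomial.C (MvPolynomial.X 0) ^ a * Polynomial.C (MvPolynomial.X 1) ^ b) ∈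
      bernsteinIdeal fourLines (MvPolynomial.X 0 ^ 2) := by
  change MemDSpan _ _
  convert (MemDSpan.pderiv hx 0).add (MemDSpan.pderiv hy 1) using 2 with m
  refine mul_left_cancel₀ fourLines_ne_zero ?_
  have h0 := mul_pderiv_pow fourLines 0 m
  have h1 := mul_pderiv_pow fourLines 1 m
  have hE := euler_fourLines
  have h01 : MvPolynomial.pderiv 0 (MvPolynomial.X 1 : MvPolynomial (Fin 2) ℚ) = 0 :=
    MvPolynomial.pderiv_X_of_ne (by decide)
  have h10 : MvPolynomial.pderiv 1 (MvPolynomial.X 0 : MvPolynomial (Fin 2) ℚ) = 0 :=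
    MvPolynomial.pderiv_X_of_ne (by decide)
  have hc : (MvPolynomial.C (Polynomial.eval (m : ℚ)
      (c * (Polynomial.C 4 * Polynomial.X + Polynomial.C (a + b + 4 : ℚ)))) :
        MvPolynomial (Fin 2) ℚ) =
      MvPolynomial.C (Polynomial.eval (m : ℚ) c) * (4 * (m : MvPolynomial (Fin 2) ℚ) +
        ((a : MvPolynomial (Fin 2) ℚ) + (b : MvPolynomial (Fin 2) ℚ) + 4)) := by
    simp only [Polynomial.eval_add, Polynomial.eval_mul, Polynomial.eval_X,
      Polynomial.eval_natCast, Polynomial.eval_ofNat, map_add, map_mul, map_natCast, map_ofNat]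
  simp only [Polynomial.eval_mul, Polynomial.eval_pow, Polynomial.eval_C, eval_natCast_map_C]
  simp only [← Polynomial.eval_mul, hc]
  generalize fourLines ^ m = G at *
  simp only [MvPolynomial.pderiv_mul, MvPolynomial.pderiv_pow, MvPolynomial.pderiv_X_self,
    MvPolynomial.pderiv_C, h01, h10, Nat.add_sub_cancel]
  push_cast
  linear_combination (-MvPolynomial.C (Polynomial.eval (m : ℚ) c) *
    MvPolynomial.X 0 ^ a * MvPolynomial.X 1 ^ b * MvPolynomial.X 0 ^ 2) *
      (MvPolynomial.X 0 * h0 + MvPolynomial.X 1 * h1 + m * G * hE)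

theorem satisfiesBS_of_dvd {b : Polynomial ℚ}
    (h : (Polynomial.X + Polynomial.C (1 : ℚ)) ^ 2 *
            (Polynomial.X + Polynomial.C (5 / 4 : ℚ)) *
            (Polynomial.X + Polynomial.C (3 / 2 : ℚ)) *
            (Polynomial.X + Polynomial.C (7 / 4 : ℚ)) *
            (Polynomial.X + Polynomial.C (2 : ℚ)) *
            (Polynomial.X + Polynomial.C (3 : ℚ)) ∣ b) :
    SatisfiesBS fourLines (MvPolynomial.X 0 ^ 2) b := by
  have lower : ∀ (k : ℕ) (c : Polynomial ℚ),
      (∀ i j, i + j = k + 1 → c.map MvPolynomial.C *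
        (Polynomial.C (MvPolynomial.X 0) ^ i * Polynomial.C (MvPolynomial.X 1) ^ j) ∈
        bernsteinIdeal fourLines (MvPolynomial.X 0 ^ 2)) →
      ∀ i j, i + j = k →
        (c * (Polynomial.C 4 * Polynomial.X + Polynomial.C (k + 4 : ℚ))).map MvPolynomial.C *
          (Polynomial.C (MvPolynomial.X 0) ^ i * Polynomial.C (MvPolynomial.X 1) ^ j) ∈
          bernsteinIdeal fourLines (MvPolynomial.X 0 ^ 2) := by
    rintro k c hc i j rfl
    simpa using euler_mul_mem (hc (i + 1) j (by ring)) (hc i (j + 1) (by ring))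
  have top : ∀ i j, i + j = 4 + 1 →
      ((Polynomial.X + 1) * (Polynomial.X + 3) : Polynomial ℚ).map
        MvPolynomial.C *
        (Polynomial.C (MvPolynomial.X 0) ^ i * Polynomial.C (MvPolynomial.X 1) ^ j) ∈
        bernsteinIdeal fourLines (MvPolynomial.X 0 ^ 2) := by
    simpa using quintic_mem
  have h0 := lower 0 _ (lower 1 _ (lower 2 _ (lower 3 _ (lower 4 _ top)))) 0 0 rfl
  rw [pow_zero, pow_zero, mul_one, mul_one] at h0
  obtain ⟨q, rfl⟩ := h
  rw [← map_C_mem_bernsteinIdeal_iff]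
  convert Ideal.mul_mem_left _ ((Polynomial.C (1 / 1024 : ℚ) * q).map MvPolynomial.C) h0 using 1
  rw [← Polynomial.map_mul]
  congr 1
  refine Polynomial.funext fun r => ?_
  simp only [Polynomial.eval_mul, Polynomial.eval_add, Polynomial.eval_pow, Polynomial.eval_X,
    Polynomial.eval_C, Polynomial.eval_one, Polynomial.eval_ofNat]
  push_cast
  ring

end UpperBound

section LowerBound

theorem eval_C_map_C {σ : Type*} (b : Polynomial ℚ) (c : ℚ) :
    Polynomial.eval (MvPolynomial.C c : MvPolynomial σ ℚ) (b.map MvPolynomial.C) =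
      MvPolynomial.C (Polynomial.eval c b) :=
  Polynomial.eval_map_apply MvPolynomial.C c

/-- The action of `∂_i` on `q f^(c - N)`, with the result in the form `q' f^(c - N - 1)`. -/
noncomputable def twistedDeriv {σ : Type*} (f : MvPolynomial σ ℚ) (c : ℚ) (N : ℕ) (i : σ)
    (q : MvPolynomial σ ℚ) : MvPolynomial σ ℚ :=
  f * MvPolynomial.pderiv i q + MvPolynomial.C (c - N) * q * MvPolynomial.pderiv i f

theorem eval_twistedDeriv {σ : Type*} (f : MvPolynomial σ ℚ) (c : ℚ) (N : ℕ) (i : σ)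
    (v : Polynomial (MvPolynomial σ ℚ)) :
    Polynomial.eval (MvPolynomial.C c) (Polynomial.C f * coeffDeriv i v +
      (Polynomial.X - Polynomial.C (N : MvPolynomial σ ℚ)) * v *
        Polynomial.C (MvPolynomial.pderiv i f)) =
      twistedDeriv f c N i (Polynomial.eval (MvPolynomial.C c) v) := by
  simp [twistedDeriv, eval_coeffDeriv]

theorem eval_neg_three_eq_zero {b : Polynomial ℚ}
    (hb : SatisfiesBS fourLines (MvPolynomial.X 0 ^ 2) b) : Polynomial.eval (-3) b = 0 := by
  let h : MvPolynomial (Fin 2) ℚ := MvPolynomial.X 1 *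
    (MvPolynomial.X 0 + MvPolynomial.X 1) * (MvPolynomial.X 0 + 2 * MvPolynomial.X 1)
  have hf : fourLines = MvPolynomial.X 0 * h := by simp only [fourLines, h]; ring
  obtain ⟨N, q, hq⟩ := hb.exists_of_closed fourLines_ne_zero
    (P := fun N v => MvPolynomial.X 0 ^ (N + 3) ∣
      Polynomial.eval (MvPolynomial.C (-3) : MvPolynomial (Fin 2) ℚ) v)
    (fun N u v hu hv => by simpa using dvd_add hu hv)
    (fun N v hv => by
      rw [Polynomial.eval_mul, Polynomial.eval_C, hf, add_right_comm, pow_succ', mul_assoc]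
      exact mul_dvd_mul_left _ (hv.mul_left _))
    (fun N i v hv => by
      rw [eval_twistedDeriv, twistedDeriv]
      obtain ⟨u, hu⟩ := hv
      refine ⟨h * MvPolynomial.pderiv i u - MvPolynomial.C (N + 3 : ℚ) * u *
        MvPolynomial.pderiv i h, ?_⟩
      rw [hu, hf, MvPolynomial.pderiv_mul, MvPolynomial.pderiv_mul, MvPolynomial.pderiv_pow,
        Nat.add_sub_cancel (n := N + 2) (m := 1)]
      simp only [map_sub, map_add, map_neg, map_natCast, map_ofNat]
      push_cast
      ring)
    (fun p => by
      refine ⟨Polynomial.eval (MvPolynomial.C (-3)) p * h, ?_⟩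
      rw [Polynomial.eval_mul, Polynomial.eval_C, hf]
      ring) 1
  rw [Polynomial.eval_mul, Polynomial.eval_C, eval_C_map_C, one_mul, hf, mul_pow] at hq
  have hq' : MvPolynomial.C (Polynomial.eval (-3) b) * h ^ N = MvPolynomial.X 0 * q := by
    refine mul_left_cancel₀ (pow_ne_zero (N + 2) (MvPolynomial.X_ne_zero (0 : Fin 2))) ?_
    linear_combination hq
  have := congrArg (MvPolynomial.eval ![0, 1]) hq'
  simpa [h] using this

/-- The substitution `x = x`, `y = t x`, with values in polynomials in `x` over `ℚ[t]`. -/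
noncomputable def chart : MvPolynomial (Fin 2) ℚ →ₐ[ℚ] Polynomial (Polynomial ℚ) :=
  MvPolynomial.aeval ![Polynomial.X, Polynomial.C Polynomial.X * Polynomial.X]

theorem chart_X_zero : chart (MvPolynomial.X 0) = Polynomial.X := by simp [chart]

theorem chart_X_one : chart (MvPolynomial.X 1) = Polynomial.C Polynomial.X * Polynomial.X := by
  simp [chart]

theorem chart_C (c : ℚ) : chart (MvPolynomial.C c) = Polynomial.C (Polynomial.C c) := by
  simp [chart]

theorem chart_monomial (u : Fin 2 →₀ ℕ) (a : ℚ) : chart (MvPolynomial.monomial u a) =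
    Polynomial.C (Polynomial.C a * Polynomial.X ^ u 1) * Polynomial.X ^ (u 0 + u 1) := by
  rw [MvPolynomial.monomial_eq, map_mul, chart_C, Finsupp.prod_fintype _ _ (by simp)]
  simp only [Fin.prod_univ_two, map_mul, map_pow, chart_X_zero, chart_X_one]
  ring

theorem coeff_chart_pderiv_one (q : MvPolynomial (Fin 2) ℚ) (n : ℕ) :
    (chart (MvPolynomial.pderiv 1 q)).coeff n =
      Polynomial.derivative ((chart q).coeff (n + 1)) := by
  induction q using MvPolynomial.induction_on' with
  | add p q hp hq => simp [hp, hq]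
  | monomial u a =>
    rw [MvPolynomial.pderiv_monomial, chart_monomial, chart_monomial,
      Polynomial.coeff_C_mul_X_pow, Polynomial.coeff_C_mul_X_pow]
    rcases Nat.eq_zero_or_pos (u 1) with h | h
    · simp [h, apply_ite]
    · have h0 : (u - Finsupp.single 1 1 : Fin 2 →₀ ℕ) 0 = u 0 := by simp
      have h1 : (u - Finsupp.single 1 1 : Fin 2 →₀ ℕ) 1 = u 1 - 1 := by simp
      have : n = u 0 + (u 1 - 1) ↔ n + 1 = u 0 + u 1 := by lia
      rw [h0, h1]
      simp only [this]
      split_ifs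
      · simp [Polynomial.derivative_X_pow]
        ring
      · simp

theorem coeff_chart_pderiv_zero (q : MvPolynomial (Fin 2) ℚ) (n : ℕ) :
    (chart (MvPolynomial.pderiv 0 q)).coeff n =
      ((n : Polynomial ℚ) + 1) * (chart q).coeff (n + 1) -
        Polynomial.X * Polynomial.derivative ((chart q).coeff (n + 1)) := by
  induction q using MvPolynomial.induction_on' with
  | add p q hp hq => simp [hp, hq]; ring
  | monomial u a =>
    rw [MvPolynomial.pderiv_monomial, chart_monomial, chart_monomial,
      Polynomial.coeff_C_mul_X_pow, Polynomial.coeff_C_mul_X_pow]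
    have hX : Polynomial.X * Polynomial.derivative (Polynomial.C a * Polynomial.X ^ u 1) =
        (u 1 : Polynomial ℚ) * (Polynomial.C a * Polynomial.X ^ u 1) := by
      rcases Nat.eq_zero_or_pos (u 1) with h | h
      · simp [h]
      · obtain ⟨k, hk⟩ := Nat.exists_eq_add_of_lt h
        rw [hk]
        simp
        ring
    have h0 : (u - Finsupp.single 0 1 : Fin 2 →₀ ℕ) 0 = u 0 - 1 := by simp
    have h1 : (u - Finsupp.single 0 1 : Fin 2 →₀ ℕ) 1 = u 1 := by simp
    rw [h0, h1]
    rcases Nat.eq_zero_or_pos (u 0) with h | h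
    · split_ifs with h2 h3 h3
      · lia
      · simp [h]
      · have hn : (n : Polynomial ℚ) + 1 = (u 1 : Polynomial ℚ) := by
          rw [h, zero_add] at h3
          rw [← h3]
          push_cast
          rfl
        rw [hX, hn, sub_self]
      · simp
    · have : n = u 0 - 1 + u 1 ↔ n + 1 = u 0 + u 1 := by lia
      simp only [this]
      split_ifs with h2
      · have hn : (n : Polynomial ℚ) + 1 = (u 0 : Polynomial ℚ) + (u 1 : Polynomial ℚ) := by
          exact_mod_cast congrArg (Nat.cast : ℕ → Polynomial ℚ) h2
        rw [hX, hn]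
        simp
        ring
      · simp

/-- The restriction of `fourLines` to the chart `x = 1`. -/
noncomputable def threePoints : Polynomial ℚ :=
  Polynomial.X * (1 + Polynomial.X) * (1 + 2 * Polynomial.X)

theorem chart_fourLines : chart fourLines = Polynomial.C threePoints * Polynomial.X ^ 4 := by
  simp only [fourLines, threePoints, map_mul, map_add, chart_X_zero, chart_X_one, map_ofNat,
    map_one]
  ring

theorem derivative_threePoints :
    Polynomial.derivative threePoints = 6 * Polynomial.X ^ 2 + 6 * Polynomial.X + 1 := by
  simp [threePoints]
  ring

theorem chart_pderiv_one_fourLines : chart (MvPolynomial.pderiv 1 fourLines) =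
    Polynomial.C (Polynomial.derivative threePoints) * Polynomial.X ^ 3 := by
  rw [pderiv_one_fourLines, derivative_threePoints]
  simp only [map_mul, map_add, map_pow, chart_X_zero, chart_X_one, map_ofNat, map_one]
  ring

theorem chart_pderiv_zero_fourLines : chart (MvPolynomial.pderiv 0 fourLines) =
    Polynomial.C (4 * threePoints - Polynomial.X * Polynomial.derivative threePoints) *
      Polynomial.X ^ 3 := by
  rw [pderiv_zero_fourLines, derivative_threePoints, threePoints]
  simp only [map_mul, map_add, map_sub, map_pow, chart_X_zero, chart_X_one, map_ofNat, map_one]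
  ring

/-- The rational function `q / f₁^N`, with `f₁ = threePoints`, lies in
`∇ ℚ[t, 1 / f₁] + ℚ f₁`, where `∇ = ∂_t + c f₁' / f₁`. -/
def IsExactModLine (c : ℚ) (N : ℕ) (q : Polynomial ℚ) : Prop :=
  ∃ (K : ℕ) (w : Polynomial ℚ) (a : ℚ), threePoints ^ (K + 1) * q = threePoints ^ N *
    (threePoints * Polynomial.derivative w +
      Polynomial.C (c - K) * w * Polynomial.derivative threePoints +
      Polynomial.C a * threePoints ^ (K + 2))

theorem IsExactModLine.add {c : ℚ} {N : ℕ} {p q : Polynomial ℚ} (hp : IsExactModLine c N p)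
    (hq : IsExactModLine c N q) : IsExactModLine c N (p + q) := by
  have raise : ∀ (r : Polynomial ℚ) (K : ℕ) (w : Polynomial ℚ) (a : ℚ),
      threePoints ^ (K + 1) * r = threePoints ^ N *
        (threePoints * Polynomial.derivative w +
          Polynomial.C (c - K) * w * Polynomial.derivative threePoints +
          Polynomial.C a * threePoints ^ (K + 2)) → ∀ n : ℕ, ∃ w' : Polynomial ℚ,
      threePoints ^ (K + n + 1) * r = threePoints ^ N *
        (threePoints * Polynomial.derivative w' +
          Polynomial.C (c - (K + n : ℕ)) * w' * Polynomial.derivative threePoints +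
          Polynomial.C a * threePoints ^ (K + n + 2)) := by
    intro r K w a h n
    induction n with
    | zero => exact ⟨w, h⟩
    | succ n ih =>
      obtain ⟨w', hw'⟩ := ih
      refine ⟨w' * threePoints, ?_⟩
      rw [Polynomial.derivative_mul]
      simp only [map_sub, map_natCast] at hw' ⊢
      push_cast at hw' ⊢
      linear_combination threePoints * hw'
  obtain ⟨K, w, a, hw⟩ := hp
  obtain ⟨M, u, d, hu⟩ := hq
  obtain ⟨w', hw'⟩ := raise _ _ _ _ hw M
  obtain ⟨u', hu'⟩ := raise _ _ _ _ hu K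
  refine ⟨K + M, w' + u', a + d, ?_⟩
  rw [add_comm M K] at hu'
  simp only [map_add]
  linear_combination hw' + hu'

theorem IsExactModLine.shift {c : ℚ} {N : ℕ} {q : Polynomial ℚ} (hq : IsExactModLine c N q) :
    IsExactModLine c (N + 1) (threePoints * q) := by
  obtain ⟨K, w, a, hw⟩ := hq
  exact ⟨K, w, a, by linear_combination threePoints * hw⟩

theorem isExactModLine_twisted (c : ℚ) (N : ℕ) (w : Polynomial ℚ) :
    IsExactModLine c (N + 1) (threePoints * Polynomial.derivative w +
      Polynomial.C (c - N) * w * Polynomial.derivative threePoints) :=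
  ⟨N, w, 0, by simp⟩

theorem isExactModLine_line (c a : ℚ) : IsExactModLine c 0 (Polynomial.C a * threePoints) :=
  ⟨0, 0, a, by simp; ring⟩

theorem coeff_chart_fourLines_mul (q : MvPolynomial (Fin 2) ℚ) (n : ℕ) :
    (chart (fourLines * q)).coeff (n + 4) = threePoints * (chart q).coeff n := by
  rw [map_mul, chart_fourLines, mul_assoc, Polynomial.coeff_C_mul, mul_comm (Polynomial.X ^ 4),
    Polynomial.coeff_mul_X_pow]

/-- The twisted derivatives are exact in the degree complementary to that of the
volume form `dx dy`. -/
theorem isExactModLine_twistedDeriv (k N : ℕ) (c : ℚ) (hk : (k : ℚ) + 2 + 4 * c = 0) (i : Fin 2)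
    (q : MvPolynomial (Fin 2) ℚ) :
    IsExactModLine c (N + 1) ((chart (twistedDeriv fourLines c N i q)).coeff
      (k + 4 * (N + 1))) := by
  have hk' : k + 4 * (N + 1) = k + 4 * N + 4 := by ring
  have e1 : ∀ r, (chart (q * r)).coeff (k + 4 * (N + 1)) = (chart q * chart r).coeff
      (k + 4 * N + 1 + 3) := fun r => by
    rw [map_mul, show k + 4 * (N + 1) = k + 4 * N + 1 + 3 by ring]
  have hmul : MvPolynomial.C (c - N) * q * MvPolynomial.pderiv i fourLines =
      MvPolynomial.C (c - N) * (q * MvPolynomial.pderiv i fourLines) := by ring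
  rw [twistedDeriv, map_add, Polynomial.coeff_add, hmul, map_mul chart (MvPolynomial.C _),
    chart_C, Polynomial.coeff_C_mul, e1, hk', coeff_chart_fourLines_mul]
  fin_cases i
  · simp only [Fin.zero_eta, coeff_chart_pderiv_zero, chart_pderiv_zero_fourLines]
    rw [mul_left_comm, Polynomial.coeff_C_mul, Polynomial.coeff_mul_X_pow]
    convert isExactModLine_twisted c N (-(Polynomial.X * (chart q).coeff (k + 4 * N + 1))) using 1
    have hk2 : Polynomial.C ((k : ℚ) + 2 + 4 * c) = 0 := by rw [hk, map_zero]
    simp only [map_add, map_mul, map_sub, map_natCast, map_ofNat, Polynomial.derivative_neg,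
      Polynomial.derivative_mul, Polynomial.derivative_X] at hk2 ⊢
    push_cast
    linear_combination threePoints * (chart q).coeff (k + 4 * N + 1) * hk2
  · simp only [Fin.mk_one, coeff_chart_pderiv_one, chart_pderiv_one_fourLines]
    rw [mul_left_comm, Polynomial.coeff_C_mul, Polynomial.coeff_mul_X_pow]
    convert isExactModLine_twisted c N ((chart q).coeff (k + 4 * N + 1)) using 1
    ring

theorem coeff_zero_chart (p : MvPolynomial (Fin 2) ℚ) :
    (chart p).coeff 0 = Polynomial.C (MvPolynomial.coeff 0 p) := by
  induction p using MvPolynomial.induction_on' with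
  | add p q hp hq => simp [hp, hq]
  | monomial u a =>
    rw [chart_monomial, Polynomial.coeff_C_mul_X_pow, MvPolynomial.coeff_monomial]
    have : u = 0 ↔ 0 = u 0 + u 1 := by
      rw [Finsupp.ext_iff, Fin.forall_fin_two]
      simp
      lia
    simp only [this]
    split_ifs with h
    · have : u 1 = 0 := by lia
      simp [this]
    · simp

theorem isExactModLine_base (c : ℚ) {k : ℕ} (hk : k ≤ 6) (p : MvPolynomial (Fin 2) ℚ) :
    IsExactModLine c 0 ((chart (p * (MvPolynomial.X 0 ^ 2 * fourLines))).coeff k) := by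
  have h : chart (p * (MvPolynomial.X 0 ^ 2 * fourLines)) =
      Polynomial.C threePoints * (chart p * Polynomial.X ^ 6) := by
    rw [map_mul, map_mul, chart_fourLines, map_pow, chart_X_zero]
    ring
  rw [h, Polynomial.coeff_C_mul, Polynomial.coeff_mul_X_pow', mul_comm]
  split_ifs
  · obtain rfl : k = 6 := by lia
    rw [coeff_zero_chart]
    exact isExactModLine_line c _
  · simpa using isExactModLine_line c 0

theorem coeff_chart_mul_fourLines_pow {φ : MvPolynomial (Fin 2) ℚ} {q : Polynomial ℚ} {j : ℕ}
    (hφ : chart φ = Polynomial.C q * Polynomial.X ^ j) (β : ℚ) (N : ℕ) :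
    (chart (MvPolynomial.C β * (φ * MvPolynomial.X 0 ^ 2 * fourLines ^ N))).coeff
      (j + 2 + 4 * N) = Polynomial.C β * q * threePoints ^ N := by
  have h : chart (MvPolynomial.C β * (φ * MvPolynomial.X 0 ^ 2 * fourLines ^ N)) =
      Polynomial.C (Polynomial.C β * q * threePoints ^ N) * Polynomial.X ^ (j + 2 + 4 * N) := by
    simp only [map_mul, map_pow, chart_fourLines, chart_X_zero, chart_C, hφ]
    ring
  rw [h, Polynomial.coeff_C_mul_X_pow, if_pos rfl]

theorem exists_isExactModLine {b : Polynomial ℚ}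
    (hb : SatisfiesBS fourLines (MvPolynomial.X 0 ^ 2) b) {j : ℕ} (hj : j ≤ 4) {c : ℚ}
    (hc : (j : ℚ) + 4 + 4 * c = 0) {φ : MvPolynomial (Fin 2) ℚ} {q : Polynomial ℚ}
    (hφ : chart φ = Polynomial.C q * Polynomial.X ^ j) :
    ∃ N, IsExactModLine c N (Polynomial.C (Polynomial.eval c b) * q * threePoints ^ N) := by
  obtain ⟨N, hN⟩ := hb.exists_of_closed fourLines_ne_zero
    (P := fun N v => IsExactModLine c N
      ((chart (Polynomial.eval (MvPolynomial.C c) v)).coeff (j + 2 + 4 * N)))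
    (fun N u v hu hv => by simpa using hu.add hv)
    (fun N v hv => by
      rw [Polynomial.eval_mul, Polynomial.eval_C, mul_add, ← add_assoc, mul_one,
        coeff_chart_fourLines_mul]
      exact hv.shift)
    (fun N i v _ => by
      rw [eval_twistedDeriv]
      exact isExactModLine_twistedDeriv (j + 2) N c (by push_cast; linarith) i _)
    (fun p => by
      rw [Polynomial.eval_mul, Polynomial.eval_C]
      exact isExactModLine_base c (by lia) _) φ
  rw [Polynomial.eval_mul, Polynomial.eval_C, eval_C_map_C, coeff_chart_mul_fourLines_pow hφ] at hN
  exact ⟨N, hN⟩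

theorem exists_isExactModLine_derivative {b : Polynomial ℚ}
    (hb : SatisfiesBS fourLines (MvPolynomial.X 0 ^ 2) b) :
    ∃ N, IsExactModLine (-1) N (Polynomial.C (Polynomial.eval (-1) (Polynomial.derivative b)) *
      1 * threePoints ^ N) := by
  obtain ⟨N, -, hN⟩ := hb.exists_of_closed fourLines_ne_zero
    (P := fun N v => fourLines ^ (N + 1) ∣ Polynomial.eval (MvPolynomial.C (-1)) v ∧
      IsExactModLine (-1) N ((chart (Polynomial.eval (MvPolynomial.C (-1))
        (Polynomial.derivative v))).coeff (0 + 2 + 4 * N)))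
    (fun N u v hu hv => ⟨by simpa using dvd_add hu.1 hv.1, by simpa using hu.2.add hv.2⟩)
    (fun N v hv => by
      rw [Polynomial.derivative_C_mul, Polynomial.eval_mul, Polynomial.eval_mul,
        Polynomial.eval_C, mul_add, ← add_assoc, mul_one, coeff_chart_fourLines_mul, pow_succ']
      exact ⟨mul_dvd_mul_left _ hv.1, hv.2.shift⟩)
    (fun N i v ⟨⟨u, hu⟩, _⟩ => by
      refine ⟨⟨MvPolynomial.pderiv i u, ?_⟩, ?_⟩
      · rw [eval_twistedDeriv, twistedDeriv, hu, MvPolynomial.pderiv_mul,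
          MvPolynomial.pderiv_pow, Nat.add_sub_cancel]
        simp only [map_sub, map_neg, map_natCast, map_one]
        push_cast
        ring
      · have hd : Polynomial.derivative (Polynomial.C fourLines * coeffDeriv i v +
            (Polynomial.X - Polynomial.C (N : MvPolynomial (Fin 2) ℚ)) * v *
              Polynomial.C (MvPolynomial.pderiv i fourLines)) =
            (Polynomial.C fourLines * coeffDeriv i (Polynomial.derivative v) +
            (Polynomial.X - Polynomial.C (N : MvPolynomial (Fin 2) ℚ)) *
              Polynomial.derivative v * Polynomial.C (MvPolynomial.pderiv i fourLines)) +
            v * Polynomial.C (MvPolynomial.pderiv i fourLines) := by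
          simp only [Polynomial.derivative_add, Polynomial.derivative_mul,
            Polynomial.derivative_C, Polynomial.derivative_sub, Polynomial.derivative_X,
            derivative_coeffDeriv]
          ring
        have h3 : ∃ r, chart (MvPolynomial.pderiv i fourLines) =
            Polynomial.C r * Polynomial.X ^ 3 := by
          fin_cases i
          · exact ⟨_, chart_pderiv_zero_fourLines⟩
          · exact ⟨_, chart_pderiv_one_fourLines⟩
        obtain ⟨r, hr⟩ := h3
        have hz : chart (fourLines ^ (N + 1) * u * MvPolynomial.pderiv i fourLines) =
            chart u * Polynomial.C (r * threePoints ^ (N + 1)) * Polynomial.X ^ (4 * N + 7) := by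
          simp only [map_mul, map_pow, hr, chart_fourLines]
          ring
        rw [hd, Polynomial.eval_add, eval_twistedDeriv, Polynomial.eval_mul, Polynomial.eval_C,
          hu, map_add, Polynomial.coeff_add, hz, Polynomial.coeff_mul_X_pow',
          if_neg (by lia), add_zero]
        exact isExactModLine_twistedDeriv (0 + 2) N (-1) (by norm_num) i _)
    (fun p => by
      rw [Polynomial.derivative_mul, Polynomial.derivative_C, mul_zero, add_zero,
        Polynomial.eval_mul, Polynomial.eval_mul, Polynomial.eval_C]
      refine ⟨?_, isExactModLine_base (-1) (by lia) _⟩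
      rw [zero_add, pow_one]
      exact ((dvd_refl _).mul_left _).mul_left _) 1
  rw [Polynomial.derivative_mul, Polynomial.derivative_C, mul_zero, add_zero, Polynomial.eval_mul,
    Polynomial.eval_C, Polynomial.derivative_map, eval_C_map_C,
    coeff_chart_mul_fourLines_pow (q := 1) (j := 0) (by simp)] at hN
  exact ⟨N, hN⟩

theorem threePoints_ne_zero : threePoints ≠ 0 := by
  intro h
  have := congrArg (Polynomial.eval 1) h
  norm_num [threePoints] at this

theorem isCoprime_threePoints_derivative :
    IsCoprime threePoints (Polynomial.derivative threePoints) := by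
  refine ⟨-18 * (2 * Polynomial.X + 1), 1 + 12 * Polynomial.X + 12 * Polynomial.X ^ 2, ?_⟩
  rw [derivative_threePoints, threePoints]
  ring

/-- The poles of a primitive can be cleared. -/
theorem IsExactModLine.exists_polynomial {c : ℚ} (hc : c < 0) {N : ℕ} {q : Polynomial ℚ}
    (hq : IsExactModLine c N (q * threePoints ^ N)) :
    ∃ (v : Polynomial ℚ) (a : ℚ), q = threePoints * Polynomial.derivative v +
      Polynomial.C (c + 1) * v * Polynomial.derivative threePoints +
      Polynomial.C a * threePoints := by
  have step : ∀ (d : ℚ) (w r : Polynomial ℚ), d ≠ 0 →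
      threePoints * r = threePoints * Polynomial.derivative w +
        Polynomial.C d * w * Polynomial.derivative threePoints →
      ∃ v : Polynomial ℚ, r = threePoints * Polynomial.derivative v +
        Polynomial.C (d + 1) * v * Polynomial.derivative threePoints := by
    intro d w r hd h
    have h1 : threePoints ∣ Polynomial.C d * w * Polynomial.derivative threePoints :=
      ⟨r - Polynomial.derivative w, by linear_combination -h⟩
    have h2 := isCoprime_threePoints_derivative.dvd_of_dvd_mul_right h1
    have hu : IsUnit (Polynomial.C d) := Polynomial.isUnit_C.2 (isUnit_iff_ne_zero.2 hd)
    obtain ⟨v, rfl⟩ := hu.dvd_mul_left.1 h2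
    refine ⟨v, mul_left_cancel₀ threePoints_ne_zero ?_⟩
    rw [h, Polynomial.derivative_mul, map_add, map_one]
    ring
  obtain ⟨K, w, a, hw⟩ := hq
  have hw' : threePoints ^ (K + 1) * q = threePoints * Polynomial.derivative w +
      Polynomial.C (c - K) * w * Polynomial.derivative threePoints +
      Polynomial.C a * threePoints ^ (K + 2) :=
    mul_left_cancel₀ (pow_ne_zero N threePoints_ne_zero) (by linear_combination hw)
  clear hw
  induction K generalizing w with
  | zero =>
    obtain ⟨v, hv⟩ := step c w (q - Polynomial.C a * threePoints) hc.ne (by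
      simp only [Nat.cast_zero, sub_zero] at hw'
      linear_combination hw')
    exact ⟨v, a, by linear_combination hv⟩
  | succ K ih =>
    obtain ⟨v, hv⟩ := step (c - (K + 1 : ℕ)) w
      (threePoints ^ (K + 1) * q - Polynomial.C a * threePoints ^ (K + 2))
      (by push_cast; linarith [(Nat.cast_nonneg K : (0 : ℚ) ≤ K)] |> ne_of_lt) (by
      linear_combination hw')
    refine ih v ?_
    rw [show c - (K + 1 : ℕ) + 1 = c - K by push_cast; ring] at hv
    linear_combination hv

theorem natDegree_le_one_of_exact {d a β : ℚ} (hd : ∀ n : ℕ, (n : ℚ) + 2 + 3 * d ≠ 0)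
    {v : Polynomial ℚ} (h : Polynomial.C β = threePoints * Polynomial.derivative v +
      Polynomial.C d * v * Polynomial.derivative threePoints + Polynomial.C a * threePoints) :
    v.natDegree ≤ 1 := by
  by_contra! hn
  obtain ⟨n, hn⟩ := Nat.exists_eq_add_of_le hn
  have hn' : v.natDegree = n + 2 := by lia
  have h1 := congrArg (fun p => Polynomial.coeff p (n + 4)) h
  have e : threePoints * Polynomial.derivative v +
      Polynomial.C d * v * Polynomial.derivative threePoints + Polynomial.C a * threePoints =
      Polynomial.C 2 * (Polynomial.derivative v * Polynomial.X ^ 3) +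
      Polynomial.C 3 * (Polynomial.derivative v * Polynomial.X ^ 2) +
      Polynomial.derivative v * Polynomial.X ^ 1 +
      Polynomial.C (6 * d) * (v * Polynomial.X ^ 2) +
      Polynomial.C (6 * d) * (v * Polynomial.X ^ 1) + Polynomial.C d * v +
      (Polynomial.C (2 * a) * Polynomial.X ^ 3 + Polynomial.C (3 * a) * Polynomial.X ^ 2 +
        Polynomial.C a * Polynomial.X ^ 1) := by
    rw [derivative_threePoints, threePoints]
    simp only [map_mul, map_ofNat]
    ring
  have z : ∀ m, n + 2 < m → v.coeff m = 0 := fun m hm =>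
    Polynomial.coeff_eq_zero_of_natDegree_lt (hn' ▸ hm)
  rw [e] at h1
  simp only [Polynomial.coeff_add, Polynomial.coeff_C_mul, Polynomial.coeff_mul_X_pow',
    Polynomial.coeff_derivative, show 3 ≤ n + 4 by lia, show 2 ≤ n + 4 by lia,
    show 1 ≤ n + 4 by lia, if_true] at h1
  rw [Polynomial.coeff_C_of_ne_zero (by lia), Polynomial.coeff_C_of_ne_zero (by lia),
    Polynomial.coeff_C_of_ne_zero (by lia), Polynomial.coeff_C_of_ne_zero (by lia),
    show n + 4 - 3 + 1 = n + 2 by lia, show n + 4 - 2 = n + 2 by lia,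
    z (n + 2 + 1) (by lia), z (n + 4 - 1 + 1) (by lia), z (n + 4 - 1) (by lia),
    z (n + 4) (by lia), show n + 4 - 3 = n + 1 by lia] at h1
  have h2 : v.coeff (n + 2) ≠ 0 := by
    rw [← hn', Polynomial.coeff_natDegree, Polynomial.leadingCoeff_ne_zero]
    rintro rfl
    simp at hn'
  push_cast at h1
  refine mul_ne_zero (hd n) h2 ?_
  linarith

theorem eq_zero_of_exact {d a β : ℚ} (hd : ∀ n : ℕ, (n : ℚ) + 2 + 3 * d ≠ 0)
    {v : Polynomial ℚ} (h : Polynomial.C β = threePoints * Polynomial.derivative v +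
      Polynomial.C d * v * Polynomial.derivative threePoints + Polynomial.C a * threePoints) :
    β = 0 := by
  obtain ⟨r, s, rfl⟩ := Polynomial.exists_eq_X_add_C_of_natDegree_le_one
    (natDegree_le_one_of_exact hd h)
  rw [derivative_threePoints, threePoints] at h
  have h0 := congrArg (Polynomial.eval 0) h
  have h1 := congrArg (Polynomial.eval (-1)) h
  have h2 := congrArg (Polynomial.eval (-1 / 2)) h
  simp only [Polynomial.eval_add, Polynomial.eval_mul, Polynomial.eval_pow, Polynomial.eval_X,
    Polynomial.eval_C, Polynomial.eval_one, Polynomial.eval_ofNat] at h0 h1 h2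
  linarith

theorem eq_zero_of_exact_sq_mul {a β : ℚ} {v : Polynomial ℚ}
    (h : Polynomial.C β * (Polynomial.X ^ 2 * Polynomial.derivative threePoints) =
      threePoints * Polynomial.derivative v +
        Polynomial.C (-2 + 1) * v * Polynomial.derivative threePoints +
        Polynomial.C a * threePoints) :
    β = 0 := by
  have h1 : threePoints ∣ (Polynomial.C β * Polynomial.X ^ 2 + v) *
      Polynomial.derivative threePoints := by
    refine ⟨Polynomial.derivative v + Polynomial.C a, ?_⟩
    rw [show (-2 + 1 : ℚ) = -1 by norm_num, map_neg, map_one] at h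
    linear_combination h
  obtain ⟨u, hu⟩ := isCoprime_threePoints_derivative.dvd_of_dvd_mul_right h1
  obtain rfl : v = threePoints * u - Polynomial.C β * Polynomial.X ^ 2 := by
    linear_combination hu
  have h2 : Polynomial.C (2 * β) * Polynomial.X =
      threePoints * Polynomial.derivative u + Polynomial.C a := by
    refine mul_left_cancel₀ threePoints_ne_zero ?_
    simp only [Polynomial.derivative_sub, Polynomial.derivative_mul, Polynomial.derivative_C,
      Polynomial.derivative_X_pow] at h
    rw [show (-2 + 1 : ℚ) = -1 by norm_num, map_neg, map_one] at h
    rw [map_mul]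
    push_cast at h ⊢
    linear_combination h
  have e0 := congrArg (Polynomial.eval 0) h2
  have e1 := congrArg (Polynomial.eval (-1)) h2
  simp only [threePoints, Polynomial.eval_add, Polynomial.eval_mul, Polynomial.eval_X,
    Polynomial.eval_C, Polynomial.eval_one, Polynomial.eval_ofNat] at e0 e1
  linarith

theorem eval_eq_zero_of_lt_four {b : Polynomial ℚ}
    (hb : SatisfiesBS fourLines (MvPolynomial.X 0 ^ 2) b) {j : ℕ} (hj : j < 4) {c : ℚ}
    (hc : (j : ℚ) + 4 + 4 * c = 0) : Polynomial.eval c b = 0 := by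
  have hj0 : (0 : ℚ) ≤ j := Nat.cast_nonneg j
  obtain ⟨N, hN⟩ := exists_isExactModLine hb hj.le hc (φ := MvPolynomial.X 0 ^ j) (q := 1)
    (by simp [chart_X_zero])
  obtain ⟨v, a, h⟩ := hN.exists_polynomial (by linarith)
  rw [mul_one] at h
  refine eq_zero_of_exact (fun n hn => ?_) h
  have : 4 * (n + 2) = 3 * j := by
    have : (4 * (n + 2) : ℚ) = 3 * j := by linarith
    exact_mod_cast this
  lia

theorem eval_neg_two_eq_zero {b : Polynomial ℚ}
    (hb : SatisfiesBS fourLines (MvPolynomial.X 0 ^ 2) b) : Polynomial.eval (-2) b = 0 := by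
  obtain ⟨N, hN⟩ := exists_isExactModLine hb (j := 4) le_rfl (c := -2) (by norm_num)
    (φ := MvPolynomial.X 1 ^ 2 * (MvPolynomial.X 0 ^ 2 +
      6 * MvPolynomial.X 0 * MvPolynomial.X 1 + 6 * MvPolynomial.X 1 ^ 2))
    (q := Polynomial.X ^ 2 * Polynomial.derivative threePoints) (by
      rw [derivative_threePoints]
      simp only [map_mul, map_add, map_pow, chart_X_zero, chart_X_one, map_ofNat, map_one]
      ring)
  obtain ⟨v, a, h⟩ := hN.exists_polynomial (by norm_num)
  exact eq_zero_of_exact_sq_mul h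

theorem eval_derivative_neg_one_eq_zero {b : Polynomial ℚ}
    (hb : SatisfiesBS fourLines (MvPolynomial.X 0 ^ 2) b) :
    Polynomial.eval (-1) (Polynomial.derivative b) = 0 := by
  obtain ⟨N, hN⟩ := exists_isExactModLine_derivative hb
  obtain ⟨v, a, h⟩ := hN.exists_polynomial (by norm_num)
  rw [mul_one] at h
  refine eq_zero_of_exact (fun n => ?_) h
  positivity

theorem dvd_of_satisfiesBS {b : Polynomial ℚ}
    (hb : SatisfiesBS fourLines (MvPolynomial.X 0 ^ 2) b) :
    (Polynomial.X + Polynomial.C (1 : ℚ)) ^ 2 *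
        (Polynomial.X + Polynomial.C (5 / 4 : ℚ)) *
        (Polynomial.X + Polynomial.C (3 / 2 : ℚ)) *
        (Polynomial.X + Polynomial.C (7 / 4 : ℚ)) *
        (Polynomial.X + Polynomial.C (2 : ℚ)) *
        (Polynomial.X + Polynomial.C (3 : ℚ)) ∣ b := by
  have hco : ∀ {r s : ℚ}, r ≠ s →
      IsCoprime (Polynomial.X + Polynomial.C r) (Polynomial.X + Polynomial.C s) := by
    intro r s hrs
    simpa using Polynomial.isCoprime_X_sub_C_of_isUnit_sub
      (a := -r) (b := -s) (isUnit_iff_ne_zero.2 fun h => hrs (by linarith))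
  have hroot : ∀ {r : ℚ}, Polynomial.eval (-r) b = 0 → Polynomial.X + Polynomial.C r ∣ b := by
    intro r hr
    simpa using Polynomial.dvd_iff_isRoot.2 hr
  have hsq : (Polynomial.X + Polynomial.C (1 : ℚ)) ^ 2 ∣ b := by
    obtain ⟨q, rfl⟩ := hroot (r := 1) (eval_eq_zero_of_lt_four hb (j := 0) (by simp) (by norm_num))
    have h := eval_derivative_neg_one_eq_zero hb
    have hq : Polynomial.eval (-1) q = 0 := by simpa using h
    rw [sq]
    refine mul_dvd_mul_left _ ?_
    simpa using Polynomial.dvd_iff_isRoot.2 hq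
  have h5 := hroot (r := 5 / 4) (eval_eq_zero_of_lt_four hb (j := 1) (by simp) (by norm_num))
  have h6 := hroot (r := 3 / 2) (eval_eq_zero_of_lt_four hb (j := 2) (by simp) (by norm_num))
  have h7 := hroot (r := 7 / 4) (eval_eq_zero_of_lt_four hb (j := 3) (by simp) (by norm_num))
  have h2 := hroot (r := 2) (eval_neg_two_eq_zero hb)
  have h3 := hroot (r := 3) (eval_neg_three_eq_zero hb)
  have h56 := (hco (r := 1) (s := 5 / 4) (by norm_num)).pow_left.mul_dvd hsq h5
  have h67 := ((hco (r := 1) (s := 3 / 2) (by norm_num)).pow_left.mul_left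
    (hco (by norm_num))).mul_dvd h56 h6
  have h72 := (((hco (r := 1) (s := 7 / 4) (by norm_num)).pow_left.mul_left
    (hco (by norm_num))).mul_left (hco (by norm_num))).mul_dvd h67 h7
  have h23 := ((((hco (r := 1) (s := 2) (by norm_num)).pow_left.mul_left
    (hco (by norm_num))).mul_left (hco (by norm_num))).mul_left (hco (by norm_num))).mul_dvd h72 h2
  exact (((((hco (r := 1) (s := 3) (by norm_num)).pow_left.mul_left
    (hco (by norm_num))).mul_left (hco (by norm_num))).mul_left (hco (by norm_num))).mul_left
    (hco (by norm_num))).mul_dvd h23 h3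

end LowerBound

theorem bernsteinSato_stmt_17 :
    ∀ b : Polynomial ℚ,
      SatisfiesBS (X 0 * X 1 * (X 0 + X 1) * (X 0 + 2 * X 1) : MvPolynomial (Fin 2) ℚ)
          ((X 0) ^ 2) b ↔
        (Polynomial.X + Polynomial.C (1 : ℚ)) ^ 2 *
            (Polynomial.X + Polynomial.C (5 / 4 : ℚ)) *
            (Polynomial.X + Polynomial.C (3 / 2 : ℚ)) *
            (Polynomial.X + Polynomial.C (7 / 4 : ℚ)) *
            (Polynomial.X + Polynomial.C (2 : ℚ)) *
            (Polynomial.X + Polynomial.C (3 : ℚ)) ∣ b := by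
  intro b
  exact ⟨dvd_of_satisfiesBS, satisfiesBS_of_dvd⟩
end
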